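/- For the two-dimensional Ising model on the periodic L_1 × L_2 square lattice with couplings a, b > 0 in the high-temperature (disordered) regime ā > b, one has lim_{L_1→∞} (1 − Z_Λ^(−)/Z_Λ)^{1/L_1} = exp( −( γ_0 + (1/2) Σ_{k=0}^{2L_2−1} (−1)^{k+1} γ_k ) ), where γ_0 = 2(ā − b). -/

import Mathlib

/-!
The two-dimensional Ising model on the periodic `L1 × L2` square lattice.
Spins `σ_x = ±1` are encoded by `Bool` via `spinv`; `cyc i j` is cyclic translation of
`i : Fin m` by `j` steps.  `ZI` is the periodic partition function with horizontal
coupling `a` and vertical coupling `b` (including the normalization `2^{-L1 L2}` of the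
counting measure); `ZIm` is the partition function with the sign of the horizontal
coupling reversed on all horizontal links of the fixed column crossing the boundary
(i.e. antiperiodic boundary conditions in the first direction); `corrI` is the
two-point function `⟨σ_x σ_y⟩_Λ`.
-/

namespace TYIsing

/-- Cyclic shift on `Fin m` by `j` steps. -/
def cyc {m : ℕ} (i : Fin m) (j : ℕ) : Fin m := ⟨(i.val + j) % m, Nat.mod_lt _ i.pos⟩

/-- The Ising spin value `±1` encoded by a Boolean. -/
def spinv (s : Bool) : ℝ := if s then 1 else -1

/-- Periodic Ising partition function on the `L1 × L2` torus. -/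
noncomputable def ZI (L1 L2 : ℕ) (a b : ℝ) : ℝ :=
  ∑ σ : Fin L1 × Fin L2 → Bool, ((2 : ℝ)⁻¹) ^ (L1 * L2) *
    Real.exp (∑ x : Fin L1 × Fin L2,
      (a * spinv (σ x) * spinv (σ (cyc x.1 1, x.2)) +
        b * spinv (σ x) * spinv (σ (x.1, cyc x.2 1))))

/-- Twisted (antiperiodic in the first direction) Ising partition function:
the coupling `a` is reversed in sign on the horizontal links of the column crossing
the boundary. -/
noncomputable def ZIm (L1 L2 : ℕ) (a b : ℝ) : ℝ :=
  ∑ σ : Fin L1 × Fin L2 → Bool, ((2 : ℝ)⁻¹) ^ (L1 * L2) *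
    Real.exp (∑ x : Fin L1 × Fin L2,
      ((if x.1.val + 1 = L1 then -a else a) * spinv (σ x) * spinv (σ (cyc x.1 1, x.2)) +
        b * spinv (σ x) * spinv (σ (x.1, cyc x.2 1))))

/-- The finite-volume two-point function `⟨σ_x σ_y⟩_Λ`. -/
noncomputable def corrI (L1 L2 : ℕ) (a b : ℝ) (x y : Fin L1 × Fin L2) : ℝ :=
  (∑ σ : Fin L1 × Fin L2 → Bool, ((2 : ℝ)⁻¹) ^ (L1 * L2) * spinv (σ x) * spinv (σ y) *
      Real.exp (∑ w : Fin L1 × Fin L2,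
        (a * spinv (σ w) * spinv (σ (cyc w.1 1, w.2)) +
          b * spinv (σ w) * spinv (σ (w.1, cyc w.2 1))))) / ZI L1 L2 a b

end TYIsing

namespace TYIsing

open Filter

/-- The ordered product of those entries of the tuple `e` that are selected by `S`. -/
def monom {A : Type*} [Monoid A] {m : ℕ} (e : Fin m → A) (S : Fin m → Bool) : A :=
  (List.ofFn fun i => if S i then e i else 1).prod

lemma monom_succ {A : Type*} [Monoid A] {m : ℕ} (e : Fin (m + 1) → A) (S : Fin (m + 1) → Bool) :
    monom e S = (if S 0 then e 0 else 1) * monom (Fin.tail e) (Fin.tail S) := by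
  simp only [monom, List.ofFn_succ, List.prod_cons]
  rfl

lemma monom_tail_mem {A : Type*} [Ring A] [Algebra ℂ A] {m : ℕ} (e : Fin (m + 1) → A) {x : A}
    (hx : x ∈ Submodule.span ℂ (Set.range (monom (Fin.tail e)))) :
    x ∈ Submodule.span ℂ (Set.range (monom e)) ∧
      e 0 * x ∈ Submodule.span ℂ (Set.range (monom e)) := by
  induction hx using Submodule.span_induction with
  | mem x h =>
    obtain ⟨S, rfl⟩ := h
    constructor
    · apply Submodule.subset_span
      exact ⟨Fin.cons false S, by simp [monom_succ]⟩
    · apply Submodule.subset_span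
      exact ⟨Fin.cons true S, by simp [monom_succ]⟩
  | zero => simp
  | add x y _ _ hx hy =>
    rw [mul_add]
    exact ⟨add_mem hx.1 hy.1, add_mem hx.2 hy.2⟩
  | smul c x _ hx =>
    rw [mul_smul_comm]
    exact ⟨Submodule.smul_mem _ _ hx.1, Submodule.smul_mem _ _ hx.2⟩

lemma mul_mem_span_monom {A : Type*} [Ring A] [Algebra ℂ A] {m : ℕ} (e : Fin m → A)
    (β : Fin m → Fin m → ℂ) (h : ∀ i j, e i * e j + e j * e i = algebraMap ℂ A (β i j))
    (i : Fin m) : ∀ x ∈ Submodule.span ℂ (Set.range (monom e)),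
      e i * x ∈ Submodule.span ℂ (Set.range (monom e)) := by
  induction m with
  | zero => exact i.elim0
  | succ m ih =>
    intro x hx
    have ih' := fun (i : Fin m) =>
      ih (Fin.tail e) (fun i j => β i.succ j.succ) (fun i j => h _ _) i
    induction hx using Submodule.span_induction with
    | zero => simp
    | add x y _ _ hx hy => rw [mul_add]; exact add_mem hx hy
    | smul c x _ hx => rw [mul_smul_comm]; exact Submodule.smul_mem _ _ hx
    | mem x hx =>
      obtain ⟨S, rfl⟩ := hx
      have hM : monom (Fin.tail e) (Fin.tail S) ∈
          Submodule.span ℂ (Set.range (monom (Fin.tail e))) :=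
        Submodule.subset_span ⟨_, rfl⟩
      rw [monom_succ]
      generalize monom (Fin.tail e) (Fin.tail S) = y at hM
      obtain ⟨h1, h2⟩ := monom_tail_mem e hM
      refine Fin.cases ?_ (fun j => ?_) i
      · by_cases hS : S 0
        · have h00 : e 0 * e 0 = algebraMap ℂ A (β 0 0 / 2) := by
            have := h 0 0
            rw [← two_smul ℂ] at this
            rw [div_eq_inv_mul, map_mul, ← this, ← Algebra.smul_def, smul_smul]
            simp
          simp only [hS, if_true]
          rw [← mul_assoc, h00, ← Algebra.smul_def]
          exact Submodule.smul_mem _ _ h1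
        · simpa [hS] using h2
      · obtain ⟨h3, h4⟩ := monom_tail_mem e (ih' j _ hM)
        by_cases hS : S 0
        · have h0 : e j.succ * e 0 = algebraMap ℂ A (β j.succ 0) - e 0 * e j.succ := by
            rw [← h j.succ 0]; abel
          simp only [hS, if_true]
          rw [← mul_assoc, h0, sub_mul, ← Algebra.smul_def, mul_assoc]
          exact sub_mem (Submodule.smul_mem _ _ h1) h4
        · simpa [hS, Fin.tail] using h3

lemma span_monom_eq_top {A : Type*} [Ring A] [Algebra ℂ A] {m : ℕ} (e : Fin m → A)
    (β : Fin m → Fin m → ℂ) (h : ∀ i j, e i * e j + e j * e i = algebraMap ℂ A (β i j))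
    (htop : Algebra.adjoin ℂ (Set.range e) = ⊤) :
    Submodule.span ℂ (Set.range (monom e)) = ⊤ := by
  rw [eq_top_iff]
  intro x hx'
  have hx : x ∈ Algebra.adjoin ℂ (Set.range e) := htop ▸ Algebra.mem_top
  clear hx'
  have key : ∀ y ∈ Submodule.span ℂ (Set.range (monom e)),
      x * y ∈ Submodule.span ℂ (Set.range (monom e)) := by
    induction hx using Algebra.adjoin_induction with
    | mem x hx =>
      obtain ⟨i, rfl⟩ := hx
      exact fun y hy => mul_mem_span_monom e β h i y hy
    | algebraMap r =>
      intro y hy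
      rw [← Algebra.smul_def]
      exact Submodule.smul_mem _ _ hy
    | add x x' _ _ hx hx' =>
      intro y hy
      rw [add_mul]
      exact add_mem (hx y hy) (hx' y hy)
    | mul x x' _ _ hx hx' =>
      intro y hy
      rw [mul_assoc]
      exact hx _ (hx' y hy)
  have h1 : (1 : A) ∈ Submodule.span ℂ (Set.range (monom e)) :=
    Submodule.subset_span ⟨fun _ => false, by simp [monom]⟩
  simpa using key 1 h1

lemma mul_monom {A : Type*} [Ring A] [Algebra ℂ A] {m : ℕ} (e : Fin m → A) (μ : Fin m → ℂ)
    (G : A) (hμ : ∀ i, G * e i = μ i • (e i * G)) (S : Fin m → Bool) :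
    G * monom e S = (∏ i, if S i then μ i else 1) • (monom e S * G) := by
  induction m with
  | zero => simp [monom]
  | succ m ih =>
    rw [monom_succ, Fin.prod_univ_succ, mul_assoc, mul_smul, ← mul_smul_comm _ (if S 0 then e 0 else 1)]
    have : G * monom (Fin.tail e) (Fin.tail S) = (∏ i : Fin m, if S i.succ then μ i.succ else 1) •
        (monom (Fin.tail e) (Fin.tail S) * G) :=
      ih (Fin.tail e) (Fin.tail μ) (fun i => hμ _) (Fin.tail S)
    rw [← this]
    by_cases hS : S 0
    · simp only [hS, if_true]
      rw [← mul_assoc, hμ, smul_mul_assoc, mul_assoc]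
    · simp only [hS, Bool.false_eq_true, if_false, one_mul, one_smul]

lemma trace_conj {n : Type*} [Fintype n] [DecidableEq n] (G G' : Matrix n n ℂ) :
    LinearMap.trace ℂ (Matrix n n ℂ) (LinearMap.mulLeft ℂ G ∘ₗ LinearMap.mulRight ℂ G') =
      G.trace * G'.trace := by
  rw [LinearMap.trace_eq_matrix_trace ℂ (Matrix.stdBasis ℂ n n), Matrix.trace,
    Fintype.sum_prod_type, Matrix.trace, Matrix.trace, Finset.sum_mul_sum]
  refine Finset.sum_congr rfl fun i _ => Finset.sum_congr rfl fun j _ => ?_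
  rw [Matrix.diag_apply, LinearMap.toMatrix_apply, Matrix.stdBasis_eq_single]
  have : ∀ M : Matrix n n ℂ, (Matrix.stdBasis ℂ n n).repr M (i, j) = M i j := fun M => by
    simp [Matrix.stdBasis]
  rw [this]
  simp [Matrix.mul_apply, Matrix.single_apply, ite_and]

/-- If a tuple of matrices satisfies canonical anticommutation relations, generates the full matrix
algebra, and diagonalizes the conjugation by `G`, then `tr G * tr G⁻¹` is a product. -/
lemma trace_mul_trace_inv {n ι : Type*} [Fintype n] [DecidableEq n] [Fintype ι]
    (e : ι → Matrix n n ℂ) (β : ι → ι → ℂ)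
    (h : ∀ i j, e i * e j + e j * e i = algebraMap ℂ (Matrix n n ℂ) (β i j))
    (htop : Algebra.adjoin ℂ (Set.range e) = ⊤)
    (hcard : 2 ^ Fintype.card ι = Fintype.card n * Fintype.card n)
    (G G' : Matrix n n ℂ) (hG : G * G' = 1) (μ : ι → ℂ)
    (hμ : ∀ i, G * e i = μ i • (e i * G)) :
    G.trace * G'.trace = ∏ i, (1 + μ i) := by
  classical
  let q := (Fintype.equivFin ι).symm
  have hspan := span_monom_eq_top (e ∘ q) (fun i j => β (q i) (q j)) (fun i j => h _ _)
    (by rw [q.surjective.range_comp]; exact htop)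
  have hmon := mul_monom (e ∘ q) (μ ∘ q) G (fun i => hμ _)
  let b := basisOfTopLeSpanOfCardEqFinrank (monom (e ∘ q)) hspan.ge (by
    rw [Module.finrank_matrix]; simp [hcard])
  rw [← trace_conj, LinearMap.trace_eq_matrix_trace ℂ b, Matrix.trace]
  have hb : ∀ S, b S = monom (e ∘ q) S := fun S => by simp [b]
  have : ∀ S, (LinearMap.toMatrix b b
      (LinearMap.mulLeft ℂ G ∘ₗ LinearMap.mulRight ℂ G')).diag S =
      ∏ i, if S i then (μ ∘ q) i else 1 := by
    intro S
    rw [Matrix.diag_apply, LinearMap.toMatrix_apply]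
    have : (LinearMap.mulLeft ℂ G ∘ₗ LinearMap.mulRight ℂ G') (b S) =
        (∏ i, if S i then (μ ∘ q) i else 1) • b S := by
      simp only [LinearMap.comp_apply, LinearMap.mulLeft_apply, LinearMap.mulRight_apply]
      rw [← mul_assoc, hb, hmon, smul_mul_assoc, mul_assoc, hG, mul_one]
    rw [this, map_smul]
    simp
  simp_rw [this]
  rw [← q.prod_comp]
  have h2 := Finset.prod_univ_sum (fun _ : Fin (Fintype.card ι) => (Finset.univ : Finset Bool))
    (fun i s => if s then (μ ∘ q) i else 1)
  rw [Fintype.piFinset_univ] at h2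
  rw [← h2]
  exact Finset.prod_congr rfl fun i _ => by simp [add_comm]

/-- The complex spin value `±1` encoded by a Boolean. -/
def zspin (s : Bool) : ℂ := if s then 1 else -1

lemma zspin_mul_self (s : Bool) : zspin s * zspin s = 1 := by cases s <;> simp [zspin]

lemma zspin_xor (s t : Bool) : zspin (xor s t) = if t then -zspin s else zspin s := by
  cases s <;> cases t <;> simp [zspin]

lemma zspin_not (s : Bool) : zspin (!s) = -zspin s := by cases s <;> simp [zspin]

/-- The operator that flips the spins selected by `d` and multiplies by the function `s`. -/
def flipMat {L : ℕ} (s : (Fin L → Bool) → ℂ) (d : Fin L → Bool) :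
    Matrix (Fin L → Bool) (Fin L → Bool) ℂ :=
  Matrix.of fun σ τ => if τ = (fun i => xor (σ i) (d i)) then s σ else 0

lemma flipMat_mul {L : ℕ} (s s' : (Fin L → Bool) → ℂ) (d d' : Fin L → Bool) :
    flipMat s d * flipMat s' d' =
      flipMat (fun σ => s σ * s' (fun i => xor (σ i) (d i))) (fun i => xor (d i) (d' i)) := by
  ext σ τ
  rw [Matrix.mul_apply, Finset.sum_eq_single (fun i => xor (σ i) (d i))]
  · simp [flipMat]
  · intro ρ _ hρ
    simp [flipMat, hρ]
  · simp

lemma flipMat_one {L : ℕ} : flipMat (fun _ => 1) (fun _ => false) =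
    (1 : Matrix (Fin L → Bool) (Fin L → Bool) ℂ) := by
  ext σ τ
  simp [flipMat, Matrix.one_apply, eq_comm]

lemma flipMat_false {L : ℕ} (s : (Fin L → Bool) → ℂ) :
    flipMat s (fun _ => false) = Matrix.diagonal s := by
  ext σ τ
  simp [flipMat, Matrix.diagonal_apply, eq_comm]

lemma flipMat_smul {L : ℕ} (c : ℂ) (s : (Fin L → Bool) → ℂ) (d : Fin L → Bool) :
    c • flipMat s d = flipMat (fun σ => c * s σ) d := by
  ext σ τ
  simp [flipMat]

lemma flipMat_neg {L : ℕ} (s : (Fin L → Bool) → ℂ) (d : Fin L → Bool) :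
    - flipMat s d = flipMat (fun σ => - s σ) d := by
  ext σ τ
  simp only [flipMat, Matrix.neg_apply, Matrix.of_apply]
  split_ifs <;> simp

lemma flipMat_congr {L : ℕ} {s s' : (Fin L → Bool) → ℂ} {d d' : Fin L → Bool}
    (hs : ∀ σ, s σ = s' σ) (hd : ∀ i, d i = d' i) : flipMat s d = flipMat s' d' := by
  rw [funext hs, funext hd]

/-- The Jordan–Wigner operators squaring to `1`. -/
def majA {L : ℕ} (j : Fin L) : Matrix (Fin L → Bool) (Fin L → Bool) ℂ :=
  flipMat (fun σ => zspin (σ j)) (fun i => decide (i < j))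

/-- The Jordan–Wigner operators squaring to `-1`. -/
def majB {L : ℕ} (j : Fin L) : Matrix (Fin L → Bool) (Fin L → Bool) ℂ :=
  flipMat (fun σ => zspin (σ j)) (fun i => decide (i ≤ j))

lemma majA_sq {L : ℕ} (j : Fin L) : majA j * majA j = 1 := by
  rw [majA, flipMat_mul, ← flipMat_one]
  exact flipMat_congr (fun σ => by simp [zspin_mul_self]) (fun i => by simp)

lemma majB_sq {L : ℕ} (j : Fin L) : majB j * majB j = -1 := by
  rw [majB, flipMat_mul, ← flipMat_one, flipMat_neg]
  exact flipMat_congr (fun σ => by simp [zspin_not, zspin_mul_self]) (fun i => by simp)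

lemma majA_anti {L : ℕ} {i j : Fin L} (h : i ≠ j) : majA i * majA j = -(majA j * majA i) := by
  rw [majA, majA, flipMat_mul, flipMat_mul, flipMat_neg]
  refine flipMat_congr (fun σ => ?_) (fun i => by simp [Bool.xor_comm])
  rcases lt_or_gt_of_ne h with h | h <;> simp [zspin_not, h, h.not_gt, mul_comm]

lemma majB_anti {L : ℕ} {i j : Fin L} (h : i ≠ j) : majB i * majB j = -(majB j * majB i) := by
  rw [majB, majB, flipMat_mul, flipMat_mul, flipMat_neg]
  refine flipMat_congr (fun σ => ?_) (fun i => by simp [Bool.xor_comm])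
  rcases lt_or_gt_of_ne h with h | h <;> simp [zspin_not, h.le, h.not_ge, mul_comm]

lemma majA_majB_anti {L : ℕ} (i j : Fin L) : majA i * majB j = -(majB j * majA i) := by
  rw [majA, majB, flipMat_mul, flipMat_mul, flipMat_neg]
  refine flipMat_congr (fun σ => ?_) (fun i => by simp [Bool.xor_comm])
  rcases lt_or_ge j i with h | h <;> simp [zspin_not, h, not_le_of_gt, not_lt_of_ge, mul_comm]

lemma majA_mul_majB {L : ℕ} (j : Fin L) :
    majA j * majB j = flipMat (fun _ => 1) (fun i => decide (i = j)) := by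
  rw [majA, majB, flipMat_mul]
  refine flipMat_congr (fun σ => by simp [zspin_mul_self]) (fun i => ?_)
  rcases lt_trichotomy i j with h | h | h <;> simp [h, le_of_lt, ne_of_lt, ne_of_gt, not_lt_of_gt, not_le_of_gt]

/-- The global spin flip. -/
def parMat (L : ℕ) : Matrix (Fin L → Bool) (Fin L → Bool) ℂ :=
  flipMat (fun _ => 1) (fun _ => true)

lemma parMat_sq (L : ℕ) : parMat L * parMat L = 1 := by
  rw [parMat, flipMat_mul, ← flipMat_one]
  exact flipMat_congr (fun σ => by simp) (fun i => by simp)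

lemma parMat_majA {L : ℕ} (j : Fin L) : parMat L * majA j = -(majA j * parMat L) := by
  rw [parMat, majA, flipMat_mul, flipMat_mul, flipMat_neg]
  exact flipMat_congr (fun σ => by simp [zspin_not]) (fun i => by simp [Bool.xor_comm])

lemma parMat_majB {L : ℕ} (j : Fin L) : parMat L * majB j = -(majB j * parMat L) := by
  rw [parMat, majB, flipMat_mul, flipMat_mul, flipMat_neg]
  exact flipMat_congr (fun σ => by simp [zspin_not]) (fun i => by simp [Bool.xor_comm])

/-- An operator reversing the sign of all products `majA i * majB j`. -/
def revMat (L : ℕ) : Matrix (Fin L → Bool) (Fin L → Bool) ℂ :=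
  flipMat (fun σ => ∏ i, zspin (σ i)) (fun i => decide (Odd i.val))

lemma prod_zspin_xor {L : ℕ} (σ d : Fin L → Bool) :
    ∏ i, zspin (xor (σ i) (d i)) = (∏ i, if d i then (-1 : ℂ) else 1) * ∏ i, zspin (σ i) := by
  rw [← Finset.prod_mul_distrib]
  refine Finset.prod_congr rfl fun i _ => ?_
  rw [zspin_xor]
  split_ifs <;> simp

lemma prod_zspin_sq {L : ℕ} (σ : Fin L → Bool) :
    (∏ i, zspin (σ i)) * (∏ i, zspin (σ i)) = 1 := by
  rw [← Finset.prod_mul_distrib]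
  exact Finset.prod_eq_one fun i _ => zspin_mul_self _

lemma isUnit_revMat (L : ℕ) : IsUnit (revMat L) := by
  have h : revMat L * flipMat (fun σ => ∏ i, zspin (xor (σ i) (decide (Odd i.val))))
      (fun i => decide (Odd i.val)) = 1 := by
    rw [revMat, flipMat_mul, ← flipMat_one]
    exact flipMat_congr (fun σ => by simp [prod_zspin_sq]) (fun i => by simp)
  exact IsUnit.of_mul_eq_one _ h

lemma prod_sign_lt {L : ℕ} (j : Fin L) :
    (∏ i : Fin L, if decide (i < j) then (-1 : ℂ) else 1) = (-1) ^ j.val := by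
  simp [Finset.prod_ite]
  congr 1
  rw [← Fin.card_Iio j]
  congr 1
  ext i
  simp

lemma prod_sign_le {L : ℕ} (j : Fin L) :
    (∏ i : Fin L, if decide (i ≤ j) then (-1 : ℂ) else 1) = (-1) ^ (j.val + 1) := by
  simp [Finset.prod_ite]
  congr 1
  rw [← Fin.card_Iic j]
  congr 1
  ext i
  simp

lemma revMat_majA {L : ℕ} (j : Fin L) : revMat L * majA j = majA j * revMat L := by
  rw [revMat, majA, flipMat_mul, flipMat_mul]
  refine flipMat_congr (fun σ => ?_) (fun i => by simp [Bool.xor_comm])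
  rw [prod_zspin_xor, prod_sign_lt, zspin_xor]
  rcases Nat.even_or_odd j.val with h | h
  · simp [h.neg_one_pow, Nat.not_odd_iff_even.mpr h]; ring
  · simp [h.neg_one_pow, h]; ring

lemma revMat_majB {L : ℕ} (j : Fin L) : revMat L * majB j = -(majB j * revMat L) := by
  rw [revMat, majB, flipMat_mul, flipMat_mul, flipMat_neg]
  refine flipMat_congr (fun σ => ?_) (fun i => by simp [Bool.xor_comm])
  rw [prod_zspin_xor, prod_sign_le, zspin_xor, pow_succ]
  rcases Nat.even_or_odd j.val with h | h
  · simp [h.neg_one_pow, Nat.not_odd_iff_even.mpr h]; ring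
  · simp [h.neg_one_pow, h]; ring

lemma revMat_parMat (L : ℕ) : revMat L * parMat L = (-1 : ℂ) ^ L • (parMat L * revMat L) := by
  rw [revMat, parMat, flipMat_mul, flipMat_mul, flipMat_smul]
  refine flipMat_congr (fun σ => ?_) (fun i => by simp [Bool.xor_comm])
  rw [prod_zspin_xor]
  simp [← mul_assoc, ← mul_pow]

lemma adjoin_maj_eq_top {L : ℕ}
    (S : Subalgebra ℂ (Matrix (Fin L → Bool) (Fin L → Bool) ℂ))
    (hA : ∀ j, majA j ∈ S) (hB : ∀ j, majB j ∈ S) : S = ⊤ := by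
  have hflip1 : ∀ j : Fin L, flipMat (fun _ => 1) (fun i => decide (i = j)) ∈ S := fun j => by
    rw [← majA_mul_majB]
    exact mul_mem (hA j) (hB j)
  have hflip2 : ∀ t : Finset (Fin L), flipMat (fun _ => 1) (fun i => decide (i ∈ t)) ∈ S := by
    intro t
    induction t using Finset.induction_on with
    | empty =>
      simp only [Finset.notMem_empty, decide_false, flipMat_one]
      exact one_mem S
    | insert j t hj ih =>
      have := mul_mem (hflip1 j) ih
      rw [flipMat_mul] at this
      convert this using 2
      · simp
      · ext i
        by_cases hi : i = j
        · simp [hi, hj]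
        · simp [hi]
  have hflip : ∀ d : Fin L → Bool, flipMat (fun _ => 1) d ∈ S := fun d => by
    simpa using hflip2 (Finset.univ.filter fun i => d i = true)
  have hz : ∀ j : Fin L, Matrix.diagonal (fun σ : Fin L → Bool => zspin (σ j)) ∈ S := fun j => by
    have := mul_mem (hA j) (hflip fun i => decide (i < j))
    rw [majA, flipMat_mul] at this
    rw [← flipMat_false]
    convert this using 2
    · simp
    · simp
  have hd : ∀ ρ : Fin L → Bool, Matrix.diagonal (fun σ => ∏ j, ((1 + zspin (ρ j) * zspin (σ j)) / 2))
      ∈ S := fun ρ => by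
    have : (∏ j : Fin L, (fun σ : Fin L → Bool => (1 + zspin (ρ j) * zspin (σ j)) / 2)) ∈
        S.comap (Matrix.diagonalAlgHom ℂ) := by
      refine prod_mem fun j _ => ?_
      have h1 : (fun σ : Fin L → Bool => (1 + zspin (ρ j) * zspin (σ j)) / 2) =
          (2⁻¹ : ℂ) • (1 : (Fin L → Bool) → ℂ) +
            (zspin (ρ j) / 2) • (fun σ : Fin L → Bool => zspin (σ j)) := by
        ext σ
        simp
        ring
      rw [h1]
      exact add_mem (Subalgebra.smul_mem _ (one_mem _) _) (Subalgebra.smul_mem (S.comap (Matrix.diagonalAlgHom ℂ)) (hz j) _)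
    rw [Subalgebra.mem_comap, Matrix.diagonalAlgHom_apply] at this
    have h2 : (fun σ : Fin L → Bool => ∏ j, ((1 + zspin (ρ j) * zspin (σ j)) / 2)) =
        ∏ j : Fin L, (fun σ : Fin L → Bool => (1 + zspin (ρ j) * zspin (σ j)) / 2) := by
      ext σ
      simp
    rw [h2]
    exact this
  have hdelta : ∀ ρ σ : Fin L → Bool,
      ∏ j, ((1 + zspin (ρ j) * zspin (σ j)) / 2) = if σ = ρ then 1 else 0 := by
    intro ρ σ
    split_ifs with h
    · subst h
      simp [zspin_mul_self]
    · obtain ⟨j, hj⟩ := Function.ne_iff.mp h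
      refine Finset.prod_eq_zero (Finset.mem_univ j) ?_
      revert hj
      cases σ j <;> cases ρ j <;> simp [zspin]
  rw [eq_top_iff]
  intro M _
  rw [Matrix.matrix_eq_sum_single M]
  refine sum_mem fun σ _ => sum_mem fun τ _ => ?_
  have : Matrix.single σ τ (M σ τ) = M σ τ •
      (Matrix.diagonal (fun σ' => ∏ j, ((1 + zspin (σ j) * zspin (σ' j)) / 2)) *
        flipMat (fun _ => 1) (fun i => xor (σ i) (τ i))) := by
    ext σ' τ'
    simp only [hdelta]
    rw [Matrix.smul_apply, Matrix.diagonal_mul]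
    simp only [flipMat, Matrix.of_apply, Matrix.single_apply]
    by_cases h : σ = σ'
    · subst h
      simp [eq_comm]
    · simp [h, Ne.symm h]
  rw [this]
  exact Subalgebra.smul_mem _ (mul_mem (hd σ) (hflip _)) _

lemma exp_smul_one {n : Type*} [Fintype n] [DecidableEq n] (c : ℂ) :
    NormedSpace.exp (c • (1 : Matrix n n ℂ)) = Complex.exp c • (1 : Matrix n n ℂ) := by
  rw [Matrix.smul_one_eq_diagonal, Matrix.exp_diagonal, Matrix.smul_one_eq_diagonal]
  congr 1
  ext i
  rw [Pi.coe_exp, Complex.exp_eq_exp_ℂ]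

lemma exp_semiconj {n : Type*} [Fintype n] [DecidableEq n] {x Q R : Matrix n n ℂ}
    (h : x * Q = R * x) : x * NormedSpace.exp Q = NormedSpace.exp R * x := by
  open scoped Matrix.Norms.Operator in
  exact (show SemiconjBy x Q R from h).exp_right

lemma exp_smul_mul {n : Type*} [Fintype n] [DecidableEq n] (Q x : Matrix n n ℂ) (t c : ℂ)
    (h : Q * x - x * Q = c • x) :
    NormedSpace.exp (t • Q) * x = Complex.exp (t * c) • (x * NormedSpace.exp (t • Q)) := by
  have h1 : x * (t • Q + (t * c) • 1) = (t • Q) * x := by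
    have h' : Q * x = x * Q + c • x := by rw [← h]; abel
    rw [mul_add, mul_smul_comm, mul_smul_comm, smul_mul_assoc, h', mul_one, smul_add,
      smul_smul]
  rw [← exp_semiconj h1, Matrix.exp_add_of_commute _ _ ((Commute.one_right _).smul_right _),
    exp_smul_one,
    mul_smul_comm, mul_smul_comm, mul_one]

lemma exp_smul_mul_pair {n : Type*} [Fintype n] [DecidableEq n] (Q u v : Matrix n n ℂ) (t p : ℂ)
    (hp : p ≠ 0) (hu : Q * u - u * Q = (2 * p) • v) (hv : Q * v - v * Q = (2 * p⁻¹) • u) :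
    NormedSpace.exp (t • Q) * u =
      (Complex.cosh (2 * t) • u + (p * Complex.sinh (2 * t)) • v) * NormedSpace.exp (t • Q) := by
  have h1 := exp_smul_mul Q (u + p • v) t 2 (by
    have : Q * (u + p • v) - (u + p • v) * Q = (Q * u - u * Q) + p • (Q * v - v * Q) := by
      rw [mul_add, add_mul, mul_smul_comm, smul_mul_assoc, smul_sub]; abel
    rw [this, hu, hv, smul_smul, smul_add, smul_smul, mul_left_comm, mul_inv_cancel₀ hp]
    rw [mul_one, add_comm])
  have h2 := exp_smul_mul Q (u - p • v) t (-2) (by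
    have : Q * (u - p • v) - (u - p • v) * Q = (Q * u - u * Q) - p • (Q * v - v * Q) := by
      rw [mul_sub, sub_mul, mul_smul_comm, smul_mul_assoc, smul_sub]; abel
    rw [this, hu, hv, smul_smul, smul_sub, smul_smul, mul_left_comm, mul_inv_cancel₀ hp]
    rw [mul_one, neg_smul, neg_mul, neg_smul]; abel)
  generalize NormedSpace.exp (t • Q) = E at h1 h2
  have h3 : E * u = (2⁻¹ : ℂ) • (E * (u + p • v) + E * (u - p • v)) := by
    rw [← mul_add, ← mul_smul_comm]
    congr 1
    module
  rw [h3, h1, h2, Complex.cosh, Complex.sinh, mul_comm t 2, mul_neg, mul_comm t 2]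
  simp only [add_mul, sub_mul, smul_mul_assoc]
  module

lemma exp_smul_commute {n : Type*} [Fintype n] [DecidableEq n] (Q R x : Matrix n n ℂ) (t : ℂ)
    (h : Q * x = x * R) :
    NormedSpace.exp (t • Q) * x = x * NormedSpace.exp (t • R) :=
  (exp_semiconj (by rw [mul_smul_comm, smul_mul_assoc, h])).symm

lemma anti_anti_commute {A : Type*} [Ring A] {x y p : A} (hx : x * p = -(p * x))
    (hy : y * p = -(p * y)) : x * y * p = p * (x * y) := by
  rw [mul_assoc, hy, mul_neg, ← mul_assoc, hx, neg_mul, neg_neg, mul_assoc]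

/-- The sum of the operators flipping one spin. -/
def ham1 (L : ℕ) : Matrix (Fin L → Bool) (Fin L → Bool) ℂ := ∑ j, majA j * majB j

/-- The sign picked up by crossing the boundary. -/
def bdry {L : ℕ} (η : ℂ) (j : Fin L) : ℂ := if j.val + 1 = L then η else 1

/-- The fermionic nearest-neighbour interaction with boundary sign `η`. -/
def ham2 (L : ℕ) (η : ℂ) : Matrix (Fin L → Bool) (Fin L → Bool) ℂ :=
  ∑ j, bdry η j • (majB j * majA (cyc j 1))

lemma cyc_injective {L : ℕ} : Function.Injective (fun j : Fin L => cyc j 1) := by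
  intro i j h
  simp only [cyc, Fin.mk.injEq] at h
  ext
  have hi := i.isLt
  have hj := j.isLt
  rcases Nat.lt_or_ge (i.val + 1) L with h1 | h1 <;> rcases Nat.lt_or_ge (j.val + 1) L with h2 | h2
  · rw [Nat.mod_eq_of_lt h1, Nat.mod_eq_of_lt h2] at h; omega
  · rw [Nat.mod_eq_of_lt h1, show j.val + 1 = L by omega, Nat.mod_self] at h; omega
  · rw [Nat.mod_eq_of_lt h2, show i.val + 1 = L by omega, Nat.mod_self] at h; omega
  · omega

lemma sum_cyc {L : ℕ} {M : Type*} [AddCommMonoid M] (f : Fin L → M) :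
    ∑ j, f (cyc j 1) = ∑ j, f j :=
  (Finite.injective_iff_bijective.mp cyc_injective).sum_comp f

lemma ham1_comm_majA {L : ℕ} (j : Fin L) :
    ham1 L * majA j - majA j * ham1 L = (-2 : ℂ) • majB j := by
  rw [ham1, Finset.sum_mul, Finset.mul_sum, ← Finset.sum_sub_distrib, Finset.sum_eq_single j]
  · rw [← mul_assoc, majA_sq, one_mul, majA_majB_anti, neg_mul, mul_assoc, majA_sq, mul_one]
    module
  · intro k _ hk
    rw [anti_anti_commute (majA_anti hk) (by rw [majA_majB_anti, neg_neg]), sub_self]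
  · simp

lemma ham1_comm_majB {L : ℕ} (j : Fin L) :
    ham1 L * majB j - majB j * ham1 L = (-2 : ℂ) • majA j := by
  rw [ham1, Finset.sum_mul, Finset.mul_sum, ← Finset.sum_sub_distrib, Finset.sum_eq_single j]
  · rw [mul_assoc, majB_sq, majA_majB_anti, mul_neg, mul_neg, ← mul_assoc, majB_sq]
    simp only [mul_one, one_mul, neg_mul]
    module
  · intro k _ hk
    rw [anti_anti_commute (majA_majB_anti _ _) (majB_anti hk), sub_self]
  · simp

lemma ham2_comm_majB {L : ℕ} (η : ℂ) (j : Fin L) :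
    ham2 L η * majB j - majB j * ham2 L η = (2 * bdry η j) • majA (cyc j 1) := by
  rw [ham2, Finset.sum_mul, Finset.mul_sum, ← Finset.sum_sub_distrib, Finset.sum_eq_single j]
  · rw [smul_mul_assoc, mul_smul_comm, ← smul_sub, mul_assoc, majA_majB_anti, mul_neg,
      ← mul_assoc, majB_sq]
    simp only [neg_mul, one_mul]
    module
  · intro k _ hk
    rw [smul_mul_assoc, anti_anti_commute (majB_anti hk) (majA_majB_anti _ _), mul_smul_comm,
      sub_self]
  · simp

lemma ham2_comm_majA {L : ℕ} (η : ℂ) (j : Fin L) :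
    ham2 L η * majA (cyc j 1) - majA (cyc j 1) * ham2 L η = (2 * bdry η j) • majB j := by
  rw [ham2, Finset.sum_mul, Finset.mul_sum, ← Finset.sum_sub_distrib, Finset.sum_eq_single j]
  · rw [smul_mul_assoc, mul_smul_comm, ← smul_sub, mul_assoc, majA_sq, ← mul_assoc,
      majA_majB_anti, neg_mul, mul_assoc, majA_sq]
    simp only [mul_one]
    module
  · intro k _ hk
    rw [smul_mul_assoc, anti_anti_commute (by rw [majA_majB_anti, neg_neg])
      (majA_anti (fun h => hk (cyc_injective h))), mul_smul_comm, sub_self]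
  · simp

/-- The Fourier mode `∑ z ^ j majA j`. -/
def modeA (L : ℕ) (z : ℂ) : Matrix (Fin L → Bool) (Fin L → Bool) ℂ := ∑ j, z ^ j.val • majA j

/-- The Fourier mode `∑ z ^ j majB j`. -/
def modeB (L : ℕ) (z : ℂ) : Matrix (Fin L → Bool) (Fin L → Bool) ℂ := ∑ j, z ^ j.val • majB j

lemma bdry_phase {L : ℕ} {z η : ℂ} (hz : z ^ L = η) (j : Fin L) :
    z ^ (cyc j 1).val * bdry η j = z * z ^ j.val := by
  have hj := j.isLt
  simp only [cyc, bdry]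
  split_ifs with h
  · rw [h, Nat.mod_self, ← pow_succ', h, hz]; simp
  · rw [Nat.mod_eq_of_lt (by omega), ← pow_succ']; simp

lemma bdry_sq {L : ℕ} {η : ℂ} (hη : η * η = 1) (j : Fin L) : bdry η j * bdry η j = 1 := by
  unfold bdry
  split_ifs <;> simp [hη]

lemma ham_comm_sum {n ι : Type*} [Fintype n] [Fintype ι] (Q : Matrix n n ℂ) (c : ι → ℂ)
    (x : ι → Matrix n n ℂ) :
    Q * (∑ j, c j • x j) - (∑ j, c j • x j) * Q = ∑ j, c j • (Q * x j - x j * Q) := by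
  rw [Finset.mul_sum, Finset.sum_mul, ← Finset.sum_sub_distrib]
  refine Finset.sum_congr rfl fun j _ => ?_
  rw [mul_smul_comm, smul_mul_assoc, smul_sub]

lemma ham1_comm_modeA (L : ℕ) (z : ℂ) :
    ham1 L * modeA L z - modeA L z * ham1 L = (2 * (-1) : ℂ) • modeB L z := by
  rw [modeA, ham_comm_sum, modeB, Finset.smul_sum]
  refine Finset.sum_congr rfl fun j _ => ?_
  rw [ham1_comm_majA]
  module

lemma ham1_comm_modeB (L : ℕ) (z : ℂ) :
    ham1 L * modeB L z - modeB L z * ham1 L = (2 * (-1)⁻¹ : ℂ) • modeA L z := by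
  rw [modeB, ham_comm_sum, modeA, Finset.smul_sum]
  refine Finset.sum_congr rfl fun j _ => ?_
  rw [ham1_comm_majB, smul_smul, smul_smul]
  congr 1
  ring

lemma ham2_comm_modeA {L : ℕ} {z η : ℂ} (hz : z ^ L = η) :
    ham2 L η * modeA L z - modeA L z * ham2 L η = (2 * z) • modeB L z := by
  have : modeA L z = ∑ j : Fin L, z ^ (cyc j 1).val • majA (cyc j 1) :=
    (sum_cyc fun j => z ^ j.val • majA j).symm
  rw [this, ham_comm_sum, modeB, Finset.smul_sum]
  refine Finset.sum_congr rfl fun j _ => ?_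
  rw [ham2_comm_majA, smul_smul, smul_smul]
  congr 1
  linear_combination 2 * bdry_phase hz j

lemma ham2_comm_modeB {L : ℕ} {z η : ℂ} (hz0 : z ≠ 0) (hz : z ^ L = η) (hη : η * η = 1) :
    ham2 L η * modeB L z - modeB L z * ham2 L η = (2 * z⁻¹) • modeA L z := by
  have : modeA L z = ∑ j : Fin L, z ^ (cyc j 1).val • majA (cyc j 1) :=
    (sum_cyc fun j => z ^ j.val • majA j).symm
  rw [this, modeB, ham_comm_sum, Finset.smul_sum]
  refine Finset.sum_congr rfl fun j _ => ?_
  rw [ham2_comm_majB, smul_smul, smul_smul]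
  congr 1
  have h1 := bdry_phase hz j
  have h2 := bdry_sq hη j
  field_simp
  linear_combination (-bdry η j) * h1 + z ^ (cyc j 1).val * h2

/-- One-row transfer operators. -/
noncomputable def fermT (L : ℕ) (η s t : ℂ) : Matrix (Fin L → Bool) (Fin L → Bool) ℂ :=
  NormedSpace.exp (t • ham2 L η) * NormedSpace.exp (s • ham1 L)

/-- Each eigenvector of the one-particle matrix gives an eigenvector of conjugation. -/
lemma fermT_mode {L : ℕ} {z η : ℂ} (hz0 : z ≠ 0) (hz : z ^ L = η) (hη : η * η = 1) (s t μ u v : ℂ)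
    (h1 : (Complex.cosh (2 * t) * Complex.cosh (2 * s) -
        z⁻¹ * Complex.sinh (2 * t) * Complex.sinh (2 * s)) * u +
      (z⁻¹ * Complex.sinh (2 * t) * Complex.cosh (2 * s) -
        Complex.cosh (2 * t) * Complex.sinh (2 * s)) * v = μ * u)
    (h2 : (z * Complex.sinh (2 * t) * Complex.cosh (2 * s) -
        Complex.cosh (2 * t) * Complex.sinh (2 * s)) * u +
      (Complex.cosh (2 * t) * Complex.cosh (2 * s) -
        z * Complex.sinh (2 * t) * Complex.sinh (2 * s)) * v = μ * v) :
    fermT L η s t * (u • modeA L z + v • modeB L z) =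
      μ • ((u • modeA L z + v • modeB L z) * fermT L η s t) := by
  have e1 := exp_smul_mul_pair _ _ _ s (-1) (by simp) (ham1_comm_modeA L z) (ham1_comm_modeB L z)
  have e2 := exp_smul_mul_pair (ham1 L) (modeB L z) (modeA L z) s (-1) (by simp)
    (by rw [ham1_comm_modeB]; norm_num) (by rw [ham1_comm_modeA]; norm_num)
  have e3 := exp_smul_mul_pair _ _ _ t z hz0 (ham2_comm_modeA hz) (ham2_comm_modeB hz0 hz hη)
  have e4 := exp_smul_mul_pair _ _ _ t z⁻¹ (inv_ne_zero hz0) (ham2_comm_modeB hz0 hz hη)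
    (by rw [inv_inv]; exact ham2_comm_modeA hz)
  unfold fermT
  generalize NormedSpace.exp (s • ham1 L) = E at *
  generalize NormedSpace.exp (t • ham2 L η) = F at *
  rw [mul_add, mul_smul_comm, mul_smul_comm, mul_assoc, mul_assoc, e1, e2, ← mul_assoc, ← mul_assoc,
    mul_add, mul_add, mul_smul_comm, mul_smul_comm, mul_smul_comm, mul_smul_comm, e3, e4]
  generalize modeA L z = X at *
  generalize modeB L z = Y at *
  simp only [add_mul, smul_mul_assoc, smul_add, smul_smul, mul_assoc]
  generalize X * (F * E) = X' at *
  generalize Y * (F * E) = Y' at *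
  simp only [← mul_assoc]
  match_scalars
  · linear_combination h1
  · linear_combination h2

lemma exists_anticomm_of_mem_span {A : Type*} [Ring A] [Algebra ℂ A] {S : Set A}
    (h : ∀ x ∈ S, ∀ y ∈ S, ∃ c, x * y + y * x = algebraMap ℂ A c) {x y : A}
    (hx : x ∈ Submodule.span ℂ S) (hy : y ∈ Submodule.span ℂ S) :
    ∃ c, x * y + y * x = algebraMap ℂ A c := by
  induction hx, hy using Submodule.span_induction₂ with
  | mem_mem x y hx hy => exact h x hx y hy
  | zero_left y hy => exact ⟨0, by simp⟩
  | zero_right x hx => exact ⟨0, by simp⟩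
  | add_left x y z hx hy hz h₁ h₂ =>
    obtain ⟨c, hc⟩ := h₁
    obtain ⟨d, hd⟩ := h₂
    refine ⟨c + d, ?_⟩
    rw [map_add, ← hc, ← hd]
    noncomm_ring
  | add_right x y z hx hy hz h₁ h₂ =>
    obtain ⟨c, hc⟩ := h₁
    obtain ⟨d, hd⟩ := h₂
    refine ⟨c + d, ?_⟩
    rw [map_add, ← hc, ← hd]
    noncomm_ring
  | smul_left r x y hx hy h =>
    obtain ⟨c, hc⟩ := h
    refine ⟨r * c, ?_⟩
    rw [map_mul, ← hc, smul_mul_assoc, mul_smul_comm, ← smul_add, Algebra.smul_def]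
  | smul_right r x y hx hy h =>
    obtain ⟨c, hc⟩ := h
    refine ⟨r * c, ?_⟩
    rw [map_mul, ← hc, smul_mul_assoc, mul_smul_comm, ← smul_add, Algebra.smul_def]

/-- The linear span of the Jordan–Wigner operators. -/
def majSpan (L : ℕ) : Submodule ℂ (Matrix (Fin L → Bool) (Fin L → Bool) ℂ) :=
  Submodule.span ℂ (Set.range majA ∪ Set.range majB)

lemma exists_anticomm_of_mem_majSpan {L : ℕ} {x y : Matrix (Fin L → Bool) (Fin L → Bool) ℂ}
    (hx : x ∈ majSpan L) (hy : y ∈ majSpan L) :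
    ∃ c, x * y + y * x = algebraMap ℂ _ c := by
  refine exists_anticomm_of_mem_span ?_ hx hy
  rintro _ (⟨i, rfl⟩ | ⟨i, rfl⟩) _ (⟨j, rfl⟩ | ⟨j, rfl⟩)
  · by_cases h : i = j
    · exact ⟨2, by rw [h, majA_sq, map_ofNat, one_add_one_eq_two]⟩
    · exact ⟨0, by rw [majA_anti h]; simp⟩
  · exact ⟨0, by rw [majA_majB_anti]; simp⟩
  · exact ⟨0, by rw [majA_majB_anti]; simp⟩
  · by_cases h : i = j
    · exact ⟨-2, by rw [h, majB_sq, map_neg, map_ofNat, ← neg_add, one_add_one_eq_two]⟩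
    · exact ⟨0, by rw [majB_anti h]; simp⟩

lemma parMat_mul_of_mem_majSpan {L : ℕ} {x : Matrix (Fin L → Bool) (Fin L → Bool) ℂ}
    (hx : x ∈ majSpan L) : parMat L * x = -(x * parMat L) := by
  unfold majSpan at hx
  induction hx using Submodule.span_induction with
  | mem x hx =>
    rcases hx with ⟨i, rfl⟩ | ⟨i, rfl⟩
    · exact parMat_majA i
    · exact parMat_majB i
  | zero => simp
  | add x y _ _ hx hy => rw [mul_add, hx, hy, add_mul, neg_add]
  | smul r x _ hx => rw [mul_smul_comm, hx, smul_mul_assoc, smul_neg]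

lemma modeA_mem (L : ℕ) (z : ℂ) : modeA L z ∈ majSpan L :=
  sum_mem fun j _ => Submodule.smul_mem _ _ (Submodule.subset_span (Or.inl ⟨j, rfl⟩))

lemma modeB_mem (L : ℕ) (z : ℂ) : modeB L z ∈ majSpan L :=
  sum_mem fun j _ => Submodule.smul_mem _ _ (Submodule.subset_span (Or.inr ⟨j, rfl⟩))

/-- Inversion of the discrete Fourier transform. -/
lemma mem_of_vandermonde {V : Type*} [AddCommGroup V] [Module ℂ V] {L : ℕ} (S : Submodule ℂ V)
    (z : Fin L → ℂ) (hz : Function.Injective z) (x : Fin L → V)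
    (h : ∀ m, ∑ j : Fin L, z m ^ j.val • x j ∈ S) (j : Fin L) : x j ∈ S := by
  have hdet : IsUnit (Matrix.vandermonde z).det :=
    (Matrix.det_vandermonde_ne_zero_iff.mpr hz).isUnit
  have : x j = ∑ m, (Matrix.vandermonde z)⁻¹ j m • ∑ i : Fin L, z m ^ i.val • x i := by
    simp only [Finset.smul_sum, smul_smul]
    rw [Finset.sum_comm]
    simp only [← Finset.sum_smul]
    have h1 : ∀ i, ∑ m, (Matrix.vandermonde z)⁻¹ j m * z m ^ i.val =
        (1 : Matrix (Fin L) (Fin L) ℂ) j i := fun i => by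
      rw [← Matrix.nonsing_inv_mul _ hdet, Matrix.mul_apply]
      rfl
    simp [h1, Matrix.one_apply]
  rw [this]
  exact sum_mem fun m _ => Submodule.smul_mem _ _ (h m)

/-- The sign used to label the two eigenmodes of each momentum. -/
noncomputable def modeVal (μ : ℂ) (s : Bool) : ℂ := if s then μ else μ⁻¹

lemma exists_modes {L : ℕ} {η : ℂ} (hη : η * η = 1) (s t : ℂ) (z μ : Fin L → ℂ)
    (hz : Function.Injective z) (hz0 : ∀ m, z m ≠ 0) (hzL : ∀ m, z m ^ L = η)
    (hμ0 : ∀ m, μ m ≠ 0) (hμ : ∀ m, μ m ≠ (μ m)⁻¹)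
    (htr : ∀ m, μ m + (μ m)⁻¹ = 2 * (Complex.cosh (2 * t) * Complex.cosh (2 * s)) -
      (z m + (z m)⁻¹) * (Complex.sinh (2 * t) * Complex.sinh (2 * s)))
    (hne : ∀ m, (z m)⁻¹ * Complex.sinh (2 * t) * Complex.cosh (2 * s) -
        Complex.cosh (2 * t) * Complex.sinh (2 * s) ≠ 0) :
    ∃ e : Fin L × Bool → Matrix (Fin L → Bool) (Fin L → Bool) ℂ,
      (∀ i, e i ∈ majSpan L) ∧ Algebra.adjoin ℂ (Set.range e) = ⊤ ∧
      ∀ i, fermT L η s t * e i = modeVal (μ i.1) i.2 • (e i * fermT L η s t) := by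
  set u : Fin L → ℂ := fun m => (z m)⁻¹ * Complex.sinh (2 * t) * Complex.cosh (2 * s) -
        Complex.cosh (2 * t) * Complex.sinh (2 * s) with hu
  set v : Fin L → ℂ → ℂ := fun m w => w - (Complex.cosh (2 * t) * Complex.cosh (2 * s) -
        (z m)⁻¹ * Complex.sinh (2 * t) * Complex.sinh (2 * s)) with hv
  set e : Fin L × Bool → Matrix (Fin L → Bool) (Fin L → Bool) ℂ := fun i =>
    u i.1 • modeA L (z i.1) + v i.1 (modeVal (μ i.1) i.2) • modeB L (z i.1) with he
  refine ⟨e, fun i => ?_, ?_, fun i => ?_⟩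
  · exact add_mem (Submodule.smul_mem _ _ (modeA_mem _ _)) (Submodule.smul_mem _ _ (modeB_mem _ _))
  · have hS : ∀ i, e i ∈ Algebra.adjoin ℂ (Set.range e) := fun i =>
      Algebra.subset_adjoin ⟨i, rfl⟩
    have hB : ∀ m, modeB L (z m) ∈ Algebra.adjoin ℂ (Set.range e) := fun m => by
      have h1 := sub_mem (hS (m, true)) (hS (m, false))
      have h2 : e (m, true) - e (m, false) = (μ m - (μ m)⁻¹) • modeB L (z m) := by
        simp only [he, hv, modeVal, if_true, Bool.false_eq_true, if_false]
        module
      rw [h2] at h1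
      have h3 := Subalgebra.smul_mem _ h1 (μ m - (μ m)⁻¹)⁻¹
      rwa [smul_smul, inv_mul_cancel₀ (sub_ne_zero.mpr (hμ m)), one_smul] at h3
    have hA : ∀ m, modeA L (z m) ∈ Algebra.adjoin ℂ (Set.range e) := fun m => by
      have h1 := sub_mem (hS (m, true)) (Subalgebra.smul_mem _ (hB m)
        (v m (modeVal (μ m) true)))
      have h2 : e (m, true) - v m (modeVal (μ m) true) • modeB L (z m) = u m • modeA L (z m) := by
        simp only [he]
        module
      rw [h2] at h1
      have h3 := Subalgebra.smul_mem _ h1 (u m)⁻¹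
      rwa [smul_smul, inv_mul_cancel₀ (hne m), one_smul] at h3
    exact adjoin_maj_eq_top _
      (mem_of_vandermonde (Subalgebra.toSubmodule (Algebra.adjoin ℂ (Set.range e))) z hz majA hA)
      (mem_of_vandermonde (Subalgebra.toSubmodule (Algebra.adjoin ℂ (Set.range e))) z hz majB hB)
  · obtain ⟨m, σ⟩ := i
    have hw : modeVal (μ m) σ * modeVal (μ m) σ + 1 =
        (2 * (Complex.cosh (2 * t) * Complex.cosh (2 * s)) -
      (z m + (z m)⁻¹) * (Complex.sinh (2 * t) * Complex.sinh (2 * s))) * modeVal (μ m) σ := by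
      have h0 := hμ0 m
      rw [← htr m]
      cases σ <;> simp only [modeVal, if_true, Bool.false_eq_true, if_false] <;>
        (field_simp <;> ring)
    refine fermT_mode (hz0 m) (hzL m) hη s t _ _ _ ?_ ?_
    · simp only [hu, hv]
      ring
    · simp only [hu, hv]
      have h1 := Complex.cosh_sq (2 * t)
      have h2 := Complex.cosh_sq (2 * s)
      have h3 := mul_inv_cancel₀ (hz0 m)
      linear_combination -hw + Complex.sinh (2 * t) ^ 2 *
        (Complex.cosh (2 * s) ^ 2 - Complex.sinh (2 * s) ^ 2) * h3 +
        (Complex.sinh (2 * t) ^ 2 - Complex.cosh (2 * t) ^ 2) * h2 - h1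

lemma pow_semiconj_smul {A : Type*} [Ring A] [Algebra ℂ A] {G x : A} {μ : ℂ}
    (h : G * x = μ • (x * G)) (N : ℕ) : G ^ N * x = μ ^ N • (x * G ^ N) := by
  induction N with
  | zero => simp
  | succ N ih =>
    rw [pow_succ, mul_assoc, h, mul_smul_comm, ← mul_assoc, ih, smul_mul_assoc, smul_smul,
      mul_assoc, ← pow_succ']

lemma parMat_ham1 (L : ℕ) : ham1 L * parMat L = parMat L * ham1 L := by
  rw [ham1, Finset.sum_mul, Finset.mul_sum]
  exact Finset.sum_congr rfl fun j _ => anti_anti_commute (by rw [parMat_majA, neg_neg])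
    (by rw [parMat_majB, neg_neg])

lemma revMat_ham1 (L : ℕ) : revMat L * ham1 L = -ham1 L * revMat L := by
  rw [ham1, neg_mul, Finset.sum_mul, Finset.mul_sum, ← Finset.sum_neg_distrib]
  refine Finset.sum_congr rfl fun j _ => ?_
  rw [← mul_assoc, revMat_majA, mul_assoc, revMat_majB, mul_neg, mul_assoc]

lemma revMat_ham2 (L : ℕ) (η : ℂ) : revMat L * ham2 L η = -ham2 L η * revMat L := by
  rw [ham2, neg_mul, Finset.sum_mul, Finset.mul_sum, ← Finset.sum_neg_distrib]
  refine Finset.sum_congr rfl fun j _ => ?_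
  rw [mul_smul_comm, smul_mul_assoc, ← smul_neg, ← mul_assoc, revMat_majB, neg_mul, mul_assoc,
    revMat_majA, mul_assoc]

/-- An explicit inverse of `fermT`. -/
noncomputable def fermInv (L : ℕ) (η s t : ℂ) : Matrix (Fin L → Bool) (Fin L → Bool) ℂ :=
  NormedSpace.exp (-(s • ham1 L)) * NormedSpace.exp (-(t • ham2 L η))

lemma exp_mul_exp_neg {n : Type*} [Fintype n] [DecidableEq n] (Q : Matrix n n ℂ) :
    NormedSpace.exp Q * NormedSpace.exp (-Q) = 1 := by
  rw [← Matrix.exp_add_of_commute _ _ (Commute.neg_right (Commute.refl Q)), add_neg_cancel,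
    NormedSpace.exp_zero]

lemma fermT_mul_fermInv (L : ℕ) (η s t : ℂ) : fermT L η s t * fermInv L η s t = 1 := by
  rw [fermT, fermInv, mul_assoc, ← mul_assoc (NormedSpace.exp (s • ham1 L)), exp_mul_exp_neg,
    one_mul, exp_mul_exp_neg]

lemma exists_reversal (L : ℕ) (η s t : ℂ) :
    ∃ W : Matrix (Fin L → Bool) (Fin L → Bool) ℂ, IsUnit W ∧
      W * fermT L η s t = fermInv L η s t * W ∧ W * parMat L = (-1 : ℂ) ^ L • (parMat L * W) := by
  refine ⟨NormedSpace.exp (-(s • ham1 L)) * revMat L, (Matrix.isUnit_exp _).mul (isUnit_revMat L),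
    ?_, ?_⟩
  · rw [fermT, fermInv, mul_assoc, ← mul_assoc (revMat L), exp_semiconj (x := revMat L) (Q := t • ham2 L η) (R := -(t • ham2 L η)),
      mul_assoc (NormedSpace.exp (-(t • ham2 L η))), exp_semiconj (x := revMat L) (Q := s • ham1 L) (R := -(s • ham1 L))]
    · simp only [mul_assoc]
    · rw [mul_smul_comm, revMat_ham1, neg_mul, neg_mul, smul_mul_assoc, smul_neg]
    · rw [mul_smul_comm, revMat_ham2, neg_mul, neg_mul, smul_mul_assoc, smul_neg]
  · rw [mul_assoc, revMat_parMat, mul_smul_comm, ← mul_assoc,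
      ← exp_semiconj (Q := -(s • ham1 L)) (x := parMat L), mul_assoc]
    rw [mul_neg, neg_mul, mul_smul_comm, smul_mul_assoc, parMat_ham1]

lemma trace_eq_of_semiconj {n : Type*} [Fintype n] [DecidableEq n] {W X Y : Matrix n n ℂ}
    (hW : IsUnit W) (h : W * X = Y * W) : X.trace = Y.trace := by
  obtain ⟨w, rfl⟩ := hW
  have : Y = w * X * (↑w⁻¹ : Matrix n n ℂ) := by rw [h, mul_assoc, Units.mul_inv, mul_one]
  rw [this, Matrix.trace_mul_comm, ← mul_assoc, Units.inv_mul, one_mul]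

lemma trace_fermInv_pow (L : ℕ) (η s t : ℂ) (N : ℕ) :
    (fermInv L η s t ^ N).trace = (fermT L η s t ^ N).trace := by
  obtain ⟨W, hW, h1, -⟩ := exists_reversal L η s t
  exact (trace_eq_of_semiconj hW (SemiconjBy.pow_right h1 N)).symm

lemma trace_parMat_fermInv_pow (L : ℕ) (η s t : ℂ) (N : ℕ) :
    (fermInv L η s t ^ N * parMat L).trace = (-1) ^ L * (parMat L * fermT L η s t ^ N).trace := by
  obtain ⟨W, hW, h1, h2⟩ := exists_reversal L η s t
  have h3 : W * fermT L η s t ^ N = fermInv L η s t ^ N * W := SemiconjBy.pow_right h1 N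
  have h4 : W * (parMat L * fermT L η s t ^ N) =
      ((-1 : ℂ) ^ L • (parMat L * fermInv L η s t ^ N)) * W := by
    rw [← mul_assoc, h2, smul_mul_assoc, mul_assoc, h3, smul_mul_assoc, mul_assoc]
  rw [trace_eq_of_semiconj hW h4, Matrix.trace_smul, smul_eq_mul, ← mul_assoc, ← mul_pow,
    Matrix.trace_mul_comm]
  simp

lemma card_modes (L : ℕ) : 2 ^ Fintype.card (Fin L × Bool) =
    Fintype.card (Fin L → Bool) * Fintype.card (Fin L → Bool) := by
  simp [← pow_add, mul_two]

/-- Eigenmodes determine the traces of powers of `fermT` up to sign. -/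
lemma trace_fermT_sq {L : ℕ} {η : ℂ} (hη : η * η = 1) (s t : ℂ) (z μ : Fin L → ℂ)
    (hz : Function.Injective z) (hz0 : ∀ m, z m ≠ 0) (hzL : ∀ m, z m ^ L = η)
    (hμ0 : ∀ m, μ m ≠ 0) (hμ : ∀ m, μ m ≠ (μ m)⁻¹)
    (htr : ∀ m, μ m + (μ m)⁻¹ = 2 * (Complex.cosh (2 * t) * Complex.cosh (2 * s)) -
      (z m + (z m)⁻¹) * (Complex.sinh (2 * t) * Complex.sinh (2 * s)))
    (hne : ∀ m, (z m)⁻¹ * Complex.sinh (2 * t) * Complex.cosh (2 * s) -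
        Complex.cosh (2 * t) * Complex.sinh (2 * s) ≠ 0) (N : ℕ) :
    (fermT L η s t ^ N).trace ^ 2 = ∏ m, ((1 + μ m ^ N) * (1 + (μ m)⁻¹ ^ N)) ∧
    (parMat L * fermT L η s t ^ N).trace ^ 2 =
      ∏ m, (-((1 - μ m ^ N) * (1 - (μ m)⁻¹ ^ N))) := by
  obtain ⟨e, he, htop, hmode⟩ := exists_modes hη s t z μ hz hz0 hzL hμ0 hμ htr hne
  choose β hβ using fun i j => exists_anticomm_of_mem_majSpan (he i) (he j)
  have hinv : fermT L η s t ^ N * fermInv L η s t ^ N = 1 := by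
    have h1 := fermT_mul_fermInv L η s t
    have h2 : Commute (fermT L η s t) (fermInv L η s t) := by
      rw [Commute, SemiconjBy, h1, mul_eq_one_comm.mp h1]
    rw [← h2.mul_pow, h1, one_pow]
  have hpow := fun i => pow_semiconj_smul (hmode i) N
  constructor
  · have h := trace_mul_trace_inv e β hβ htop (card_modes L) _ _ hinv _ hpow
    rw [trace_fermInv_pow] at h
    rw [sq, h, Fintype.prod_prod_type]
    simp [modeVal]
  · have h := trace_mul_trace_inv e β hβ htop (card_modes L) (parMat L * fermT L η s t ^ N)
      (fermInv L η s t ^ N * parMat L)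
      (by rw [mul_assoc, ← mul_assoc (fermT L η s t ^ N), hinv, one_mul, parMat_sq])
      (fun i => -modeVal (μ i.1) i.2 ^ N)
      (fun i => by
        rw [mul_assoc, hpow, mul_smul_comm, ← mul_assoc, parMat_mul_of_mem_majSpan (he i), neg_mul,
          mul_assoc, smul_neg, neg_smul])
    rw [trace_parMat_fermInv_pow, Fintype.prod_prod_type] at h
    have h2 : ∏ m : Fin L, (-((1 - μ m ^ N) * (1 - (μ m)⁻¹ ^ N))) =
        (-1) ^ L * ∏ m : Fin L, ((1 - μ m ^ N) * (1 - (μ m)⁻¹ ^ N)) := by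
      rw [← Fin.prod_const, ← Finset.prod_mul_distrib]
      simp
    rw [h2]
    simp only [Fintype.prod_bool, modeVal, if_true, Bool.false_eq_true, if_false,
      ← sub_eq_add_neg] at h
    rw [← h]
    have h3 : ((-1 : ℂ) ^ L) * (-1) ^ L = 1 := by rw [← mul_pow]; simp
    linear_combination (-(parMat L * fermT L η s t ^ N).trace ^ 2) * h3

/-- The real form of `trace_fermT_sq`. -/
lemma trace_fermT_sq_real {L : ℕ} {η : ℂ} (hη : η * η = 1) {s t : ℝ} (ht : 0 ≤ t) (hts : t < s)
    (z : Fin L → ℂ) (hz : Function.Injective z) (hz1 : ∀ m, ‖z m‖ = 1)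
    (hzL : ∀ m, z m ^ L = η) (γ : Fin L → ℝ) (hγ : ∀ m, 0 < γ m)
    (hcosh : ∀ m, Real.cosh (γ m) = Real.cosh (2 * s) * Real.cosh (2 * t) -
      (z m).re * (Real.sinh (2 * s) * Real.sinh (2 * t))) (N : ℕ) :
    (fermT L η s t ^ N).trace ^ 2 = ((∏ m, (2 * Real.cosh (N * γ m / 2)) : ℝ) : ℂ) ^ 2 ∧
    (parMat L * fermT L η s t ^ N).trace ^ 2 =
      ((∏ m, (2 * Real.sinh (N * γ m / 2)) : ℝ) : ℂ) ^ 2 := by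
  have hz0 : ∀ m, z m ≠ 0 := fun m h => by simpa [h] using hz1 m
  have hzz : ∀ m, z m + (z m)⁻¹ = 2 * ((z m).re : ℂ) := fun m => by
    rw [Complex.inv_eq_conj (hz1 m), Complex.add_conj]
    push_cast
    rfl
  have h := trace_fermT_sq hη s t z (fun m => Complex.exp (γ m)) hz hz0 hzL
    (fun m => Complex.exp_ne_zero _) (fun m h => by
      rw [← Complex.exp_neg, ← Complex.ofReal_neg, ← Complex.ofReal_exp, ← Complex.ofReal_exp,
        Complex.ofReal_inj, Real.exp_eq_exp] at h
      linarith [hγ m])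
    (fun m => by
      rw [hzz, ← Complex.exp_neg]
      have h1 : Complex.exp (γ m) + Complex.exp (-γ m) = 2 * Complex.cosh (γ m) := by
        rw [Complex.cosh]; ring
      rw [h1, ← Complex.ofReal_cosh, hcosh m]
      push_cast
      ring)
    (fun m h => by
      have h1 : (z m)⁻¹ * ((Real.sinh (2 * t) * Real.cosh (2 * s) : ℝ) : ℂ) =
          ((Real.cosh (2 * t) * Real.sinh (2 * s) : ℝ) : ℂ) := by
        push_cast
        linear_combination h
      have h2 := congrArg norm h1
      have hs1 : 0 ≤ Real.sinh (2 * t) := Real.sinh_nonneg_iff.mpr (by linarith)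
      have hs2 : 0 ≤ Real.sinh (2 * s) := Real.sinh_nonneg_iff.mpr (by linarith)
      have hc1 := Real.cosh_pos (2 * t)
      have hc2 := Real.cosh_pos (2 * s)
      rw [norm_mul, norm_inv, hz1, inv_one, one_mul, Complex.norm_real, Complex.norm_real,
        Real.norm_of_nonneg (by positivity), Real.norm_of_nonneg (by positivity)] at h2
      have h3 : 0 < Real.sinh (2 * s - 2 * t) := Real.sinh_pos_iff.mpr (by linarith)
      rw [Real.sinh_sub] at h3
      linarith) N
  rw [h.1, h.2]
  push_cast
  rw [← Finset.prod_pow, ← Finset.prod_pow]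
  constructor
  · refine Finset.prod_congr rfl fun m _ => ?_
    rw [← Complex.exp_neg, ← Complex.exp_nat_mul, ← Complex.exp_nat_mul, Complex.cosh]
    have e1 : (N : ℂ) * γ m = N * γ m / 2 + N * γ m / 2 := by ring
    have e2 : (N : ℂ) * -γ m = -(N * γ m / 2) + -(N * γ m / 2) := by ring
    rw [e1, e2, Complex.exp_add, Complex.exp_add]
    have e3 : Complex.exp (N * γ m / 2) * Complex.exp (-(N * γ m / 2)) = 1 := by
      rw [← Complex.exp_add]; simp
    rw [← e1]
    linear_combination (Complex.exp (N * γ m / 2) * Complex.exp (-(N * γ m / 2)) - 1) * e3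
  · refine Finset.prod_congr rfl fun m _ => ?_
    rw [← Complex.exp_neg, ← Complex.exp_nat_mul, ← Complex.exp_nat_mul, Complex.sinh]
    have e1 : (N : ℂ) * γ m = N * γ m / 2 + N * γ m / 2 := by ring
    have e2 : (N : ℂ) * -γ m = -(N * γ m / 2) + -(N * γ m / 2) := by ring
    rw [e1, e2, Complex.exp_add, Complex.exp_add]
    have e3 : Complex.exp (N * γ m / 2) * Complex.exp (-(N * γ m / 2)) = 1 := by
      rw [← Complex.exp_add]; simp
    rw [← e1]
    linear_combination (-Complex.exp (N * γ m / 2) * Complex.exp (-(N * γ m / 2)) + 1) * e3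

lemma exp_smul_involution {n : Type*} [Fintype n] [DecidableEq n] {X : Matrix n n ℂ}
    (hX : X * X = 1) (s : ℂ) :
    NormedSpace.exp (s • X) = Complex.cosh s • (1 : Matrix n n ℂ) + Complex.sinh s • X := by
  have h1 := exp_smul_commute X 1 (1 + X) s (by rw [mul_add, hX, mul_one, mul_one, add_comm])
  have h2 := exp_smul_commute X (-1) (1 - X) s (by
    rw [mul_sub, hX, mul_one, mul_neg, mul_one, neg_sub])
  rw [exp_smul_one] at h1
  rw [smul_neg, ← neg_smul, exp_smul_one] at h2
  have h3 : NormedSpace.exp (s • X) = (2⁻¹ : ℂ) •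
      (NormedSpace.exp (s • X) * (1 + X) + NormedSpace.exp (s • X) * (1 - X)) := by
    rw [← mul_add, ← mul_smul_comm]
    have : (2⁻¹ : ℂ) • (1 + X + (1 - X)) = 1 := by module
    rw [this, mul_one]
  rw [h3, h1, h2, Complex.cosh, Complex.sinh, mul_smul_comm, mul_smul_comm, mul_one, mul_one]
  module

/-- The matrix with entries `∏ f i (σ i) (τ i)`. -/
def prodMat {L : ℕ} (f : Fin L → Bool → Bool → ℂ) : Matrix (Fin L → Bool) (Fin L → Bool) ℂ :=
  Matrix.of fun σ τ => ∏ i, f i (σ i) (τ i)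

lemma prodMat_one {L : ℕ} : prodMat (fun (_ : Fin L) a b => if a = b then (1 : ℂ) else 0) = 1 := by
  ext σ τ
  rw [Matrix.one_apply, prodMat, Matrix.of_apply, Finset.prod_ite_zero]
  simp [funext_iff]

lemma flip_mul_prodMat {L : ℕ} (j : Fin L) (c d : ℂ) (f : Fin L → Bool → Bool → ℂ) :
    (c • (1 : Matrix (Fin L → Bool) (Fin L → Bool) ℂ) + d • (majA j * majB j)) * prodMat f =
      prodMat (Function.update f j fun x y => c * f j x y + d * f j (!x) y) := by
  ext σ τ
  rw [majA_mul_majB, add_mul, smul_mul_assoc, smul_mul_assoc, one_mul, Matrix.add_apply,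
    Matrix.smul_apply, Matrix.smul_apply, Matrix.mul_apply,
    Finset.sum_eq_single (fun i => xor (σ i) (decide (i = j)))]
  · simp only [flipMat, prodMat, Matrix.of_apply, if_true, one_mul, smul_eq_mul]
    rw [← Finset.mul_prod_erase _ _ (Finset.mem_univ j),
      ← Finset.mul_prod_erase Finset.univ (fun i => f i (xor (σ i) (decide (i = j))) (τ i))
        (Finset.mem_univ j),
      ← Finset.mul_prod_erase Finset.univ (fun i => Function.update f j _ i (σ i) (τ i))
        (Finset.mem_univ j)]
    have h1 : ∏ i ∈ Finset.univ.erase j, f i (xor (σ i) (decide (i = j))) (τ i) =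
        ∏ i ∈ Finset.univ.erase j, f i (σ i) (τ i) := by
      refine Finset.prod_congr rfl fun i hi => ?_
      simp [Finset.ne_of_mem_erase hi]
    have h2 : ∏ i ∈ Finset.univ.erase j,
        Function.update f j (fun x y => c * f j x y + d * f j (!x) y) i (σ i) (τ i) =
        ∏ i ∈ Finset.univ.erase j, f i (σ i) (τ i) := by
      refine Finset.prod_congr rfl fun i hi => ?_
      rw [Function.update_of_ne (Finset.ne_of_mem_erase hi)]
    rw [h1, h2, Function.update_self]
    simp
    ring
  · intro ρ _ hρ
    simp [flipMat, hρ]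
  · simp

lemma flip_commute {L : ℕ} (i j : Fin L) : Commute (majA i * majB i) (majA j * majB j) := by
  rw [Commute, SemiconjBy, majA_mul_majB, majA_mul_majB, flipMat_mul, flipMat_mul]
  exact flipMat_congr (fun σ => by simp) fun k => Bool.xor_comm _ _

lemma exp_ham1 (L : ℕ) (s : ℂ) : NormedSpace.exp (s • ham1 L) =
    prodMat fun _ a b => if a = b then Complex.cosh s else Complex.sinh s := by
  have key : ∀ T : Finset (Fin L), NormedSpace.exp (s • ∑ j ∈ T, majA j * majB j) =
      prodMat fun i a b => if i ∈ T then (if a = b then Complex.cosh s else Complex.sinh s)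
        else if a = b then 1 else 0 := by
    intro T
    induction T using Finset.induction_on with
    | empty => simp [prodMat_one, NormedSpace.exp_zero]
    | insert j T hj ih =>
      have hX : (majA j * majB j) * (majA j * majB j) = 1 := by
        rw [majA_mul_majB, flipMat_mul, ← flipMat_one]
        exact flipMat_congr (fun σ => by simp) fun k => by simp
      rw [Finset.sum_insert hj, smul_add, Matrix.exp_add_of_commute, ih, exp_smul_involution hX,
        flip_mul_prodMat]
      · congr 1
        ext i x y
        by_cases hi : i = j
        · subst hi
          cases x <;> cases y <;> simp [hj]
        · simp [hi]
      · refine ((Commute.sum_right _ _ _ fun i _ => flip_commute j i).smul_left s).smul_right s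
  rw [ham1, key]
  simp

lemma parMat_mul_apply {L : ℕ} (M : Matrix (Fin L → Bool) (Fin L → Bool) ℂ) (σ τ : Fin L → Bool) :
    (parMat L * M) σ τ = M (fun i => !σ i) τ := by
  rw [Matrix.mul_apply, Finset.sum_eq_single (fun i => !σ i)]
  · simp [parMat, flipMat]
  · intro ρ _ hρ
    simp [parMat, flipMat, hρ]
  · simp

lemma trace_exp_ham1 (L : ℕ) (s : ℂ) :
    (NormedSpace.exp (s • ham1 L)).trace = (2 * Complex.cosh s) ^ L ∧
    (parMat L * NormedSpace.exp (s • ham1 L)).trace = (2 * Complex.sinh s) ^ L := by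
  rw [exp_ham1]
  constructor
  · simp [Matrix.trace, prodMat, mul_pow]
  · simp [Matrix.trace, parMat_mul_apply, prodMat, mul_pow]

lemma trace_fermT_zero (L : ℕ) (η s : ℂ) (N : ℕ) :
    (fermT L η s 0 ^ N).trace = (2 * Complex.cosh (N * s)) ^ L ∧
    (parMat L * fermT L η s 0 ^ N).trace = (2 * Complex.sinh (N * s)) ^ L := by
  rw [fermT, zero_smul, NormedSpace.exp_zero, one_mul, ← Matrix.exp_nsmul,
    ← Nat.cast_smul_eq_nsmul ℂ, smul_smul]
  exact trace_exp_ham1 L _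

/-- Continuity of `fermT` in the interaction strength. -/
lemma continuous_fermT (L : ℕ) (η s : ℂ) : Continuous fun t : ℝ => fermT L η s t := by
  open scoped Matrix.Norms.Operator in
  unfold fermT
  have : Continuous fun t : ℝ => NormedSpace.exp ((t : ℂ) • ham2 L η) :=
    NormedSpace.exp_continuous.comp (by fun_prop)
  exact this.mul continuous_const

/-- The argument of `arcosh` in the dispersion relation exceeds one. -/
lemma one_lt_dispersion {s t c : ℝ} (ht : 0 ≤ t) (hts : t < s) (hc : c ≤ 1) :
    1 < Real.cosh (2 * s) * Real.cosh (2 * t) - c * (Real.sinh (2 * s) * Real.sinh (2 * t)) := by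
  have h1 : 0 ≤ Real.sinh (2 * s) * Real.sinh (2 * t) :=
    mul_nonneg (Real.sinh_nonneg_iff.mpr (by linarith)) (Real.sinh_nonneg_iff.mpr (by linarith))
  have h2 : 1 < Real.cosh (2 * s - 2 * t) := Real.one_lt_cosh.mpr (by linarith)
  rw [Real.cosh_sub] at h2
  nlinarith

/-- The traces of powers of `fermT` in terms of the dispersion relation. -/
lemma trace_fermT {L : ℕ} {η : ℂ} (hη : η * η = 1) {s b : ℝ} (hb : 0 ≤ b) (hbs : b < s)
    (z : Fin L → ℂ) (hz : Function.Injective z) (hz1 : ∀ m, ‖z m‖ = 1)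
    (hzL : ∀ m, z m ^ L = η) (γ : Fin L → ℝ) (hγ : ∀ m, 0 ≤ γ m)
    (hcosh : ∀ m, Real.cosh (γ m) = Real.cosh (2 * s) * Real.cosh (2 * b) -
      (z m).re * (Real.sinh (2 * s) * Real.sinh (2 * b))) {N : ℕ} (hN : 0 < N) :
    (fermT L η s b ^ N).trace = ((∏ m, (2 * Real.cosh (N * γ m / 2)) : ℝ) : ℂ) ∧
    (parMat L * fermT L η s b ^ N).trace = ((∏ m, (2 * Real.sinh (N * γ m / 2)) : ℝ) : ℂ) := by
  have hre : ∀ m, (z m).re ≤ 1 := fun m => (Complex.re_le_norm _).trans_eq (hz1 m)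
  set D : Fin L → ℝ → ℝ := fun m t => Real.cosh (2 * s) * Real.cosh (2 * t) -
      (z m).re * (Real.sinh (2 * s) * Real.sinh (2 * t)) with hD
  set g : Fin L → ℝ → ℝ := fun m t => Real.arcosh (D m t) with hg
  have hD1 : ∀ m, ∀ t ∈ Set.Icc 0 b, 1 < D m t := fun m t ht =>
    one_lt_dispersion ht.1 (ht.2.trans_lt hbs) (hre m)
  have hg0 : ∀ m, ∀ t ∈ Set.Icc 0 b, 0 < g m t := fun m t ht => Real.arcosh_pos (hD1 m t ht)
  have hgc : ∀ m, ContinuousOn (g m) (Set.Icc 0 b) := fun m => by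
    refine Real.continuousOn_arcosh.comp (Continuous.continuousOn ?_) fun t ht => (hD1 m t ht).le
    have h1 := Real.continuous_cosh
    have h2 := Real.continuous_sinh
    fun_prop
  have hsq := fun t (ht : t ∈ Set.Icc 0 b) => trace_fermT_sq_real hη ht.1 (ht.2.trans_lt hbs) z hz
    hz1 hzL (fun m => g m t) (fun m => hg0 m t ht)
    (fun m => Real.cosh_arcosh (hD1 m t ht).le) N
  have hgb : ∀ m, g m b = γ m := fun m => by
    simp only [hg, hD]
    rw [← hcosh, Real.arcosh_cosh (hγ m)]
  have hgz : ∀ m, g m 0 = 2 * s := fun m => by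
    simp only [hg, hD]
    rw [mul_zero, Real.cosh_zero, Real.sinh_zero, mul_zero, mul_zero, sub_zero, mul_one,
      Real.arcosh_cosh (by linarith)]
  have hcont : Continuous fun t : ℝ => fermT L η s t ^ N := (continuous_fermT L η s).pow N
  have h0 : (0 : ℝ) ∈ Set.Icc 0 b := ⟨le_rfl, hb⟩
  have hb' : b ∈ Set.Icc 0 b := ⟨hb, le_rfl⟩
  have htr0 := trace_fermT_zero L η s N
  have hpos : ∀ m, ∀ t ∈ Set.Icc 0 b, 0 < (N : ℝ) * g m t / 2 := fun m t ht => by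
    have := hg0 m t ht
    positivity
  constructor
  · have := (isPreconnected_Icc (a := (0 : ℝ)) (b := b)).eq_of_sq_eq
      (f := fun t : ℝ => (fermT L η s t ^ N).trace)
      (g := fun t : ℝ => ((∏ m, (2 * Real.cosh (N * g m t / 2)) : ℝ) : ℂ))
      hcont.matrix_trace.continuousOn
      (Complex.continuous_ofReal.comp_continuousOn (continuousOn_finsetProd _ fun m _ =>
        continuousOn_const.mul (Real.continuous_cosh.comp_continuousOn
          ((continuousOn_const.mul (hgc m)).div_const 2))))
      (fun t ht => (hsq t ht).1)
      (fun {t} ht => Complex.ofReal_ne_zero.mpr (Finset.prod_ne_zero_iff.mpr fun m _ =>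
        mul_ne_zero two_ne_zero (Real.cosh_pos _).ne')) h0
      (by
        simp only [hgz]
        rw [Complex.ofReal_zero, htr0.1]
        simp [mul_div_assoc]) hb'
    simpa only [hgb] using this
  · have := (isPreconnected_Icc (a := (0 : ℝ)) (b := b)).eq_of_sq_eq
      (f := fun t : ℝ => (parMat L * fermT L η s t ^ N).trace)
      (g := fun t : ℝ => ((∏ m, (2 * Real.sinh (N * g m t / 2)) : ℝ) : ℂ))
      (continuous_const.mul hcont).matrix_trace.continuousOn
      (Complex.continuous_ofReal.comp_continuousOn (continuousOn_finsetProd _ fun m _ =>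
        continuousOn_const.mul (Real.continuous_sinh.comp_continuousOn
          ((continuousOn_const.mul (hgc m)).div_const 2))))
      (fun t ht => (hsq t ht).2)
      (fun {t} ht => Complex.ofReal_ne_zero.mpr (Finset.prod_ne_zero_iff.mpr fun m _ =>
        mul_ne_zero two_ne_zero (Real.sinh_pos_iff.mpr (hpos m t ht)).ne')) h0
      (by
        simp only [hgz]
        rw [Complex.ofReal_zero, htr0.2]
        simp [mul_div_assoc]) hb'
    simpa only [hgb] using this

lemma majB_mul_majA_cyc {L : ℕ} (η : ℂ) (j : Fin L) :
    bdry η j • (majB j * majA (cyc j 1)) =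
      (if j.val + 1 = L then -η else 1 : ℂ) •
        flipMat (fun σ => zspin (σ j) * zspin (σ (cyc j 1))) (fun _ => decide (j.val + 1 = L)) := by
  rw [majA, majB, flipMat_mul, flipMat_smul, flipMat_smul]
  have hj := j.isLt
  by_cases h : j.val + 1 = L
  · have h0 : (cyc j 1).val = 0 := by simp only [cyc, h, Nat.mod_self]
    refine flipMat_congr (fun σ => ?_) fun i => ?_
    · have : cyc j 1 ≤ j := by rw [Fin.le_def, h0]; exact Nat.zero_le _
      simp [bdry, h, this, zspin_not]
    · have h1 : i ≤ j := by rw [Fin.le_def]; omega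
      have h2 : ¬ i < cyc j 1 := by rw [Fin.lt_def, h0]; omega
      simp [h, h1, h2]
  · have h0 : (cyc j 1).val = j.val + 1 := Nat.mod_eq_of_lt (by omega)
    refine flipMat_congr (fun σ => ?_) fun i => ?_
    · have : ¬ cyc j 1 ≤ j := by rw [Fin.le_def, h0]; omega
      simp [bdry, h, this]
    · have h1 : i < cyc j 1 ↔ i ≤ j := by rw [Fin.lt_def, Fin.le_def, h0]; omega
      simp [h, h1]

/-- The nearest-neighbour interaction within one row. -/
def rowEnergy {L : ℕ} (σ : Fin L → Bool) : ℂ := ∑ j, zspin (σ j) * zspin (σ (cyc j 1))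

lemma diagonal_mul_proj {L : ℕ} {ε : ℂ} (hε : ε * ε = 1) :
    Matrix.diagonal (rowEnergy (L := L)) * (1 + ε • parMat L) =
      (1 + ε • parMat L) * ham2 L (-ε) := by
  have h1 : Matrix.diagonal (rowEnergy (L := L)) = ∑ j : Fin L,
      flipMat (fun σ => zspin (σ j) * zspin (σ (cyc j 1))) (fun _ => false) := by
    simp only [flipMat_false]
    refine Eq.trans (congrArg _ ?_)
      (map_sum (Matrix.diagonalAddMonoidHom (Fin L → Bool) ℂ)
        (fun (j : Fin L) (σ : Fin L → Bool) => zspin (σ j) * zspin (σ (cyc j 1))) Finset.univ)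
    ext σ
    simp [rowEnergy]
  rw [h1, ham2, Finset.sum_mul, Finset.mul_sum]
  refine Finset.sum_congr rfl fun j _ => ?_
  rw [majB_mul_majA_cyc, neg_neg, mul_add, add_mul, mul_one, one_mul, mul_smul_comm, mul_smul_comm,
    smul_mul_assoc, parMat, flipMat_mul, flipMat_mul]
  by_cases h : j.val + 1 = L
  · simp only [h, if_true, decide_true, smul_smul, hε, one_smul, mul_one, one_mul]
    rw [add_comm]
    congr 1
    exact flipMat_congr (fun σ => by simp [zspin_not]) fun i => by simp
  · simp only [h, if_false, decide_false, one_smul, mul_one, one_mul, Bool.xor_false,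
      Bool.xor_true]
    congr 2
    exact flipMat_congr (fun σ => by simp [zspin_not]) fun i => by simp

/-- The normalized transfer matrix of the Ising model. -/
noncomputable def spinT (L : ℕ) (s t : ℂ) : Matrix (Fin L → Bool) (Fin L → Bool) ℂ :=
  NormedSpace.exp (t • Matrix.diagonal (rowEnergy (L := L))) * NormedSpace.exp (s • ham1 L)

lemma spinT_mul_proj {L : ℕ} {ε : ℂ} (hε : ε * ε = 1) (s t : ℂ) :
    spinT L s t * (1 + ε • parMat L) = (1 + ε • parMat L) * fermT L (-ε) s t := by
  have h1 : NormedSpace.exp (s • ham1 L) * (1 + ε • parMat L) =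
      (1 + ε • parMat L) * NormedSpace.exp (s • ham1 L) :=
    exp_smul_commute _ _ _ s (by
      rw [mul_add, add_mul, mul_one, one_mul, mul_smul_comm, smul_mul_assoc, parMat_ham1])
  rw [spinT, fermT, mul_assoc, h1, ← mul_assoc, exp_smul_commute _ _ _ t (diagonal_mul_proj hε),
    mul_assoc]

lemma trace_spinT {L : ℕ} {ε : ℂ} (hε : ε * ε = 1) (s t : ℂ) (N : ℕ) :
    (spinT L s t ^ N).trace + ε * (spinT L s t ^ N * parMat L).trace =
      (fermT L (-ε) s t ^ N).trace + ε * (parMat L * fermT L (-ε) s t ^ N).trace := by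
  have h : (1 + ε • parMat L) * fermT L (-ε) s t ^ N = spinT L s t ^ N * (1 + ε • parMat L) :=
    SemiconjBy.pow_right (show SemiconjBy (1 + ε • parMat L) (fermT L (-ε) s t) (spinT L s t) from
      (spinT_mul_proj hε s t).symm) N
  have h2 := congrArg Matrix.trace h
  rw [mul_add, add_mul, mul_one, one_mul, mul_smul_comm, smul_mul_assoc, Matrix.trace_add,
    Matrix.trace_add, Matrix.trace_smul, Matrix.trace_smul, smul_eq_mul, smul_eq_mul] at h2
  exact h2.symm

/-- The transfer matrix of the Ising model. -/
noncomputable def rowMat (L : ℕ) (a b : ℝ) : Matrix (Fin L → Bool) (Fin L → Bool) ℂ :=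
  Matrix.of fun σ τ => ((Real.exp (∑ j : Fin L,
    (a * spinv (σ j) * spinv (τ j) + b * spinv (σ j) * spinv (σ (cyc j 1)))) : ℝ) : ℂ)

lemma zspin_eq (s : Bool) : zspin s = (spinv s : ℂ) := by cases s <;> simp [zspin, spinv]

lemma rowMat_eq (L : ℕ) {a b s κ : ℝ} (h1 : Real.exp a = κ * Real.cosh s)
    (h2 : Real.exp (-a) = κ * Real.sinh s) :
    rowMat L a b = (κ : ℂ) ^ L • spinT L s b := by
  ext σ τ
  have h3 : ∀ x y : Bool, Complex.exp (a * spinv x * spinv y) =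
      κ * (if x = y then Complex.cosh s else Complex.sinh s) := by
    intro x y
    have h1' := congrArg Complex.ofReal h1
    have h2' := congrArg Complex.ofReal h2
    push_cast at h1' h2'
    cases x <;> cases y <;> simp [spinv, h1', h2']
  rw [spinT, ← Matrix.diagonal_smul, Matrix.exp_diagonal, exp_ham1, Matrix.smul_apply,
    Matrix.diagonal_mul, Pi.coe_exp, rowMat, prodMat, Matrix.of_apply, Matrix.of_apply,
    Finset.sum_add_distrib]
  push_cast
  rw [Complex.exp_add, Complex.exp_sum, Finset.prod_congr rfl fun i _ => h3 (σ i) (τ i),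
    Finset.prod_mul_distrib, Fin.prod_const, ← Complex.exp_eq_exp_ℂ, Pi.smul_apply, rowEnergy,
    Finset.smul_sum]
  simp only [zspin_eq, smul_eq_mul, mul_assoc]
  ring

lemma sum_path {S R : Type*} [Fintype S] [DecidableEq S] [CommRing R] (M : Matrix S S R) (n : ℕ) :
    ∀ F : Matrix S S R, ∑ x : Fin (n + 1) → S,
      (∏ i : Fin n, M (x i.castSucc) (x i.succ)) * F (x (Fin.last n)) (x 0) =
        (M ^ n * F).trace := by
  induction n with
  | zero =>
    intro F
    rw [pow_zero, one_mul, Matrix.trace, ← (Equiv.funUnique (Fin 1) S).symm.sum_comp]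
    simp
  | succ n ih =>
    intro F
    rw [pow_succ', mul_assoc, Matrix.trace_mul_comm, mul_assoc, ← ih,
      ← (Fin.consEquiv fun _ => S).sum_comp, Fintype.sum_prod_type, Finset.sum_comm]
    refine Finset.sum_congr rfl fun y _ => ?_
    rw [Matrix.mul_apply, Finset.mul_sum]
    refine Finset.sum_congr rfl fun s _ => ?_
    simp only [Fin.consEquiv_apply, Fin.prod_univ_succ, Fin.castSucc_zero, Fin.cons_zero,
      Fin.cons_succ, ← Fin.succ_castSucc, ← Fin.succ_last]
    ring

lemma sum_torus {L N : ℕ} (f : Fin N → (Fin L → Bool) → (Fin L → Bool) → ℂ) :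
    ∑ σ : Fin N × Fin L → Bool,
      ∏ i : Fin N, f i (fun j => σ (i, j)) (fun j => σ (cyc i 1, j)) =
    ∑ x : Fin N → Fin L → Bool, ∏ i : Fin N, f i (x i) (x (cyc i 1)) :=
  Fintype.sum_equiv (Equiv.curry _ _ _) _ _ fun _ => rfl

lemma sum_cycle {S : Type*} [Fintype S] [DecidableEq S] (M F : Matrix S S ℂ) (n : ℕ) :
    ∑ x : Fin (n + 1) → S, ∏ i : Fin (n + 1),
      (if i.val + 1 = n + 1 then F (x i) (x (cyc i 1)) else M (x i) (x (cyc i 1))) = (M ^ n * F).trace := by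
  rw [← sum_path]
  refine Finset.sum_congr rfl fun x _ => ?_
  rw [Fin.prod_univ_castSucc]
  congr 1
  · refine Finset.prod_congr rfl fun i _ => ?_
    have h1 : cyc i.castSucc 1 = i.succ := by
      ext
      simp only [cyc, Fin.val_castSucc, Fin.val_succ]
      exact Nat.mod_eq_of_lt (by omega)
    rw [h1, if_neg (by rw [Fin.val_castSucc]; omega)]
  · have h1 : cyc (Fin.last n) 1 = 0 := by
      ext
      simp [cyc]
    rw [h1, if_pos (by simp)]

lemma mul_parMat_apply {L : ℕ} (M : Matrix (Fin L → Bool) (Fin L → Bool) ℂ) (σ τ : Fin L → Bool) :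
    (M * parMat L) σ τ = M σ (fun i => !τ i) := by
  rw [Matrix.mul_apply, Finset.sum_eq_single (fun i => !τ i)]
  · simp [parMat, flipMat]
  · intro ρ _ hρ
    have : τ ≠ fun i => !ρ i := fun h => hρ (by ext i; simp [h])
    simp [parMat, flipMat, this]
  · simp

lemma ZI_eq_trace (L n : ℕ) (a b : ℝ) : (ZI (n + 1) L a b : ℂ) =
    (2 : ℂ)⁻¹ ^ ((n + 1) * L) * (rowMat L a b ^ (n + 1)).trace := by
  rw [ZI, ← Finset.mul_sum]
  push_cast
  congr 1
  rw [pow_succ, ← sum_cycle, ← sum_torus fun i : Fin (n + 1) => fun σ τ =>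
    if i.val + 1 = n + 1 then rowMat L a b σ τ else rowMat L a b σ τ]
  refine Finset.sum_congr rfl fun σ _ => ?_
  rw [Fintype.sum_prod_type, Complex.exp_sum]
  refine Finset.prod_congr rfl fun i _ => ?_
  rw [ite_self, rowMat, Matrix.of_apply]
  push_cast
  rfl

lemma ZIm_eq_trace (L n : ℕ) (a b : ℝ) : (ZIm (n + 1) L a b : ℂ) =
    (2 : ℂ)⁻¹ ^ ((n + 1) * L) * (rowMat L a b ^ (n + 1) * parMat L).trace := by
  rw [ZIm, ← Finset.mul_sum]
  push_cast
  congr 1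
  rw [pow_succ, mul_assoc, ← sum_cycle, ← sum_torus fun i : Fin (n + 1) => fun σ τ =>
    if i.val + 1 = n + 1 then (rowMat L a b * parMat L) σ τ else rowMat L a b σ τ]
  refine Finset.sum_congr rfl fun σ _ => ?_
  rw [Fintype.sum_prod_type, Complex.exp_sum]
  refine Finset.prod_congr rfl fun i _ => ?_
  split_ifs with h
  · rw [mul_parMat_apply, rowMat, Matrix.of_apply]
    push_cast
    congr 1
    refine Finset.sum_congr rfl fun j _ => ?_
    rw [if_pos (show i.val = n by omega)]
    push_cast
    simp only [← zspin_eq, zspin_not]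
    ring
  · rw [rowMat, Matrix.of_apply]
    simp only [if_neg (show ¬ i.val = n by omega)]
    push_cast
    rfl

lemma exp_dual {a s : ℝ} (ha : 0 < a) (hs : 0 < s)
    (h : Real.sinh (2 * a) * Real.sinh (2 * s) = 1) :
    ∃ κ : ℝ, 0 < κ ∧ Real.exp a = κ * Real.cosh s ∧ Real.exp (-a) = κ * Real.sinh s := by
  have hc := Real.cosh_pos s
  refine ⟨Real.exp a / Real.cosh s, div_pos (Real.exp_pos _) hc, by field_simp, ?_⟩
  have key : Real.exp (-a) * Real.cosh s = Real.exp a * Real.sinh s := by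
    have ha1 : 1 < Real.exp a := Real.one_lt_exp_iff.mpr ha
    have hs1 : 1 < Real.exp s := Real.one_lt_exp_iff.mpr hs
    rw [Real.sinh_eq, Real.sinh_eq, Real.exp_neg, Real.exp_neg, two_mul, two_mul, Real.exp_add,
      Real.exp_add] at h
    rw [Real.cosh_eq, Real.sinh_eq, Real.exp_neg, Real.exp_neg]
    generalize Real.exp a = x at *
    generalize Real.exp s = y at *
    have hx : 0 < x := by linarith
    have hy : 0 < y := by linarith
    field_simp at h ⊢
    have h1 : ((x ^ 2 * y ^ 2 - 1) - (x ^ 2 + y ^ 2)) * ((x ^ 2 * y ^ 2 - 1) + (x ^ 2 + y ^ 2)) = 0 := by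
      linear_combination h
    have h2 : 0 < (x ^ 2 * y ^ 2 - 1) + (x ^ 2 + y ^ 2) := by nlinarith
    have h3 := (mul_eq_zero.mp h1).resolve_right h2.ne'
    linear_combination -h3
  field_simp
  linarith

/-- The momenta `π (2 m + δ) / L`. -/
noncomputable def phase (L δ : ℕ) (m : Fin L) : ℂ :=
  Complex.exp (((Real.pi * ((2 * m.val + δ : ℕ) : ℝ) / L : ℝ) : ℂ) * Complex.I)

lemma phase_injective {L : ℕ} (δ : ℕ) : Function.Injective (phase L δ) := by
  intro m m' h
  have hL : L ≠ 0 := by have := m.isLt; omega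
  have hL' : (L : ℂ) ≠ 0 := Nat.cast_ne_zero.mpr hL
  have h1 : ∀ m : Fin L, phase L δ m = Complex.exp (Real.pi * δ / L * Complex.I) *
      Complex.exp (2 * Real.pi * Complex.I / L) ^ m.val := fun m => by
    rw [phase, ← Complex.exp_nat_mul, ← Complex.exp_add]
    congr 1
    push_cast
    field_simp
    ring
  rw [h1, h1] at h
  exact Fin.ext ((Complex.isPrimitiveRoot_exp L hL).pow_inj m.isLt m'.isLt
    (mul_left_cancel₀ (Complex.exp_ne_zero _) h))

lemma norm_phase {L : ℕ} (δ : ℕ) (m : Fin L) : ‖phase L δ m‖ = 1 :=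
  Complex.norm_exp_ofReal_mul_I _

lemma phase_re {L : ℕ} (δ : ℕ) (m : Fin L) :
    (phase L δ m).re = Real.cos (Real.pi * ((2 * m.val + δ : ℕ) : ℝ) / L) :=
  Complex.exp_ofReal_mul_I_re _

lemma phase_pow {L : ℕ} (δ : ℕ) (m : Fin L) : phase L δ m ^ L = (-1) ^ δ := by
  have hL : L ≠ 0 := by have := m.isLt; omega
  have hL' : (L : ℂ) ≠ 0 := Nat.cast_ne_zero.mpr hL
  have h : (L : ℂ) * (((Real.pi * ((2 * m.val + δ : ℕ) : ℝ) / L : ℝ) : ℂ) * Complex.I) =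
      ((2 * m.val + δ : ℕ) : ℂ) * (Real.pi * Complex.I) := by
    push_cast
    field_simp
  rw [phase, ← Complex.exp_nat_mul, h, Complex.exp_nat_mul, Complex.exp_pi_mul_I, pow_add, pow_mul]
  simp

/-- The product of `2 cosh (N γ / 2)`. -/
noncomputable def prodCosh {L : ℕ} (γ : Fin L → ℝ) (N : ℕ) : ℝ :=
  ∏ m, (2 * Real.cosh (N * γ m / 2))

/-- The product of `2 sinh (N γ / 2)`. -/
noncomputable def prodSinh {L : ℕ} (γ : Fin L → ℝ) (N : ℕ) : ℝ :=
  ∏ m, (2 * Real.sinh (N * γ m / 2))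

/-- Exact expressions for the periodic and antiperiodic partition functions. -/
lemma partition_functions {L : ℕ} {a b s : ℝ} (ha : 0 < a) (hb : 0 < b)
    (hdual : Real.sinh (2 * a) * Real.sinh (2 * s) = 1) (hbs : b < s) (γ : ℕ → ℝ)
    (hγ : ∀ j < 2 * L, 0 ≤ γ j ∧ Real.cosh (γ j) = Real.cosh (2 * s) * Real.cosh (2 * b) -
        Real.cos (Real.pi * j / L) * (Real.sinh (2 * s) * Real.sinh (2 * b)))
    {N : ℕ} (hN : 0 < N) :
    ∃ c : ℝ, 0 < c ∧
      ZI N L a b + ZIm N L a b = c * (prodCosh (fun m : Fin L => γ (2 * m.val + 1)) N +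
        prodSinh (fun m : Fin L => γ (2 * m.val + 1)) N) ∧
      ZI N L a b - ZIm N L a b = c * (prodCosh (fun m : Fin L => γ (2 * m.val)) N -
        prodSinh (fun m : Fin L => γ (2 * m.val)) N) := by
  obtain ⟨κ, hκ, h1, h2⟩ := exp_dual ha (hb.trans hbs) hdual
  have hrow : rowMat L a b ^ N = ((κ ^ L) ^ N : ℝ) • spinT L s b ^ N := by
    rw [rowMat_eq L h1 h2, smul_pow, ← Complex.coe_smul]
    push_cast
    rfl
  obtain ⟨n, rfl⟩ : ∃ n, N = n + 1 := ⟨N - 1, by omega⟩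
  have hZ := ZI_eq_trace L n a b
  have hZm := ZIm_eq_trace L n a b
  rw [hrow, Matrix.trace_smul, Complex.real_smul] at hZ
  rw [hrow, smul_mul_assoc, Matrix.trace_smul, Complex.real_smul] at hZm
  have hodd := trace_fermT (L := L) (η := -1) (by norm_num) hb.le hbs (phase L 1)
    (phase_injective 1) (norm_phase 1) (fun m => by rw [phase_pow, pow_one])
    (fun m => γ (2 * m.val + 1)) (fun m => (hγ _ (by omega)).1)
    (fun m => by rw [phase_re]; exact (hγ _ (by omega)).2) hN
  have heven := trace_fermT (L := L) (η := 1) (by norm_num) hb.le hbs (phase L 0)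
    (phase_injective 0) (norm_phase 0) (fun m => by rw [phase_pow, pow_zero])
    (fun m => γ (2 * m.val)) (fun m => (hγ _ (by omega)).1)
    (fun m => by rw [phase_re]; exact (hγ _ (by omega)).2) hN
  have t1 := trace_spinT (L := L) (ε := 1) (by norm_num) s b (n + 1)
  have t2 := trace_spinT (L := L) (ε := -1) (by norm_num) s b (n + 1)
  rw [hodd.1, hodd.2] at t1
  rw [neg_neg, heven.1, heven.2] at t2
  refine ⟨2⁻¹ ^ ((n + 1) * L) * (κ ^ L) ^ (n + 1), by positivity, ?_, ?_⟩
  · apply Complex.ofReal_injective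
    rw [Complex.ofReal_add, hZ, hZm, Complex.ofReal_mul, Complex.ofReal_add, prodCosh, prodSinh,
      Complex.ofReal_mul]
    rw [Complex.ofReal_pow 2⁻¹, Complex.ofReal_inv, Complex.ofReal_ofNat]
    linear_combination (2⁻¹ : ℂ) ^ ((n + 1) * L) * (((κ ^ L) ^ (n + 1) : ℝ) : ℂ) * t1
  · apply Complex.ofReal_injective
    rw [Complex.ofReal_sub, hZ, hZm, Complex.ofReal_mul, Complex.ofReal_sub, prodCosh, prodSinh,
      Complex.ofReal_mul]
    rw [Complex.ofReal_pow 2⁻¹, Complex.ofReal_inv, Complex.ofReal_ofNat]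
    linear_combination (2⁻¹ : ℂ) ^ ((n + 1) * L) * (((κ ^ L) ^ (n + 1) : ℝ) : ℂ) * t2

lemma ZI_pos (N L : ℕ) (a b : ℝ) : 0 < ZI N L a b :=
  Finset.sum_pos (fun _ _ => by positivity) Finset.univ_nonempty

lemma ZIm_nonneg (N L : ℕ) (a b : ℝ) : 0 ≤ ZIm N L a b :=
  Finset.sum_nonneg fun _ _ => by positivity

lemma prodCosh_eq {L : ℕ} (γ : Fin L → ℝ) (N : ℕ) : prodCosh γ N =
    Real.exp (N * ((∑ m, γ m) / 2)) * ∏ m, (1 + Real.exp (-(N * γ m))) := by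
  rw [Finset.sum_div, Finset.mul_sum, Real.exp_sum, ← Finset.prod_mul_distrib, prodCosh]
  refine Finset.prod_congr rfl fun m _ => ?_
  rw [Real.cosh_eq, mul_add, ← Real.exp_add]
  ring_nf

lemma prodSinh_eq {L : ℕ} (γ : Fin L → ℝ) (N : ℕ) : prodSinh γ N =
    Real.exp (N * ((∑ m, γ m) / 2)) * ∏ m, (1 - Real.exp (-(N * γ m))) := by
  rw [Finset.sum_div, Finset.mul_sum, Real.exp_sum, ← Finset.prod_mul_distrib, prodSinh]
  refine Finset.prod_congr rfl fun m _ => ?_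
  rw [Real.sinh_eq, mul_sub, ← Real.exp_add]
  ring_nf

lemma prod_one_add_bounds {ι : Type*} (T : Finset ι) (u : ι → ℝ) {U : ℝ} (hU : U ≤ 1)
    (h0 : ∀ i, 0 ≤ u i) (hu : ∀ i, u i ≤ U) :
    ∏ i ∈ T, (1 + u i) ≤ 1 + (2 ^ T.card - 1) * U ∧ 1 - (2 ^ T.card - 1) * U ≤ ∏ i ∈ T, (1 - u i) ∧
      0 ≤ ∏ i ∈ T, (1 - u i) ∧ ∏ i ∈ T, (1 - u i) ≤ 1 ∧ 1 ≤ ∏ i ∈ T, (1 + u i) := by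
  classical
  induction T using Finset.induction_on with
  | empty => simp
  | insert j T hj ih =>
    obtain ⟨h1, h2, h3, h4, h5⟩ := ih
    have hj0 := h0 j
    have hjU := hu j
    rw [Finset.prod_insert hj, Finset.prod_insert hj, Finset.card_insert_of_notMem hj, pow_succ]
    generalize ∏ i ∈ T, (1 + u i) = x at *
    generalize ∏ i ∈ T, (1 - u i) = y at *
    have hp : (1 : ℝ) ≤ 2 ^ T.card := one_le_pow₀ one_le_two
    generalize (2 : ℝ) ^ T.card = p at *
    have hpU : 0 ≤ (p - 1) * U := mul_nonneg (by linarith) (by linarith)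
    refine ⟨?_, ?_, mul_nonneg (by linarith) h3, by nlinarith, by nlinarith⟩
    · nlinarith [mul_le_mul_of_nonneg_left h1 hj0, mul_nonneg hpU (by linarith : 0 ≤ 1 - u j)]
    · nlinarith

lemma sum_bounds {L : ℕ} (γ : Fin L → ℝ) (hγ : ∀ m, 0 ≤ γ m) (N : ℕ) :
    Real.exp (N * ((∑ m, γ m) / 2)) ≤ prodCosh γ N + prodSinh γ N ∧
      prodCosh γ N + prodSinh γ N ≤ 2 * 2 ^ L * Real.exp (N * ((∑ m, γ m) / 2)) := by
  have hu : ∀ m, Real.exp (-(N * γ m)) ≤ 1 := fun m =>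
    Real.exp_le_one_iff.mpr (neg_nonpos.mpr (mul_nonneg (Nat.cast_nonneg _) (hγ m)))
  obtain ⟨h1, -, h3, h4, h5⟩ := prod_one_add_bounds Finset.univ (fun m => Real.exp (-(N * γ m)))
    le_rfl (fun m => (Real.exp_pos _).le) hu
  rw [prodCosh_eq, prodSinh_eq, ← mul_add]
  rw [Finset.card_univ, Fintype.card_fin] at h1
  have hp : (1 : ℝ) ≤ 2 ^ L := one_le_pow₀ one_le_two
  have he := Real.exp_pos (N * ((∑ m, γ m) / 2))
  constructor
  · nlinarith
  · rw [mul_comm]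
    exact mul_le_mul_of_nonneg_right (by linarith) he.le

lemma diff_bounds {L : ℕ} (γ : Fin L → ℝ) (k : Fin L) (h0 : 0 ≤ γ k) (hγ : ∀ m, γ k ≤ γ m)
    (N : ℕ) :
    Real.exp (N * ((∑ m, γ m) / 2 - γ k)) ≤ prodCosh γ N - prodSinh γ N ∧
      prodCosh γ N - prodSinh γ N ≤ 2 * 2 ^ L * Real.exp (N * ((∑ m, γ m) / 2 - γ k)) := by
  have hN : (0 : ℝ) ≤ N := Nat.cast_nonneg _
  have hu : ∀ m, Real.exp (-(N * γ m)) ≤ Real.exp (-(N * γ k)) := fun m =>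
    Real.exp_le_exp.mpr (neg_le_neg (mul_le_mul_of_nonneg_left (hγ m) hN))
  have hU : Real.exp (-(N * γ k)) ≤ 1 :=
    Real.exp_le_one_iff.mpr (neg_nonpos.mpr (mul_nonneg hN h0))
  obtain ⟨h1, h2, -⟩ := prod_one_add_bounds Finset.univ (fun m => Real.exp (-(N * γ m)))
    hU (fun m => (Real.exp_pos _).le) hu
  obtain ⟨-, -, h3, h4, h5⟩ := prod_one_add_bounds (Finset.univ.erase k)
    (fun m => Real.exp (-(N * γ m))) hU (fun m => (Real.exp_pos _).le) hu
  have hexp : Real.exp (N * ((∑ m, γ m) / 2 - γ k)) =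
      Real.exp (N * ((∑ m, γ m) / 2)) * Real.exp (-(N * γ k)) := by
    rw [← Real.exp_add]
    ring_nf
  rw [prodCosh_eq, prodSinh_eq, ← mul_sub, hexp]
  rw [Finset.card_univ, Fintype.card_fin] at h1 h2
  have hp : (1 : ℝ) ≤ 2 ^ L := one_le_pow₀ one_le_two
  have he := Real.exp_pos (N * ((∑ m, γ m) / 2))
  have hk := Real.exp_pos (-(N * γ k))
  constructor
  · refine mul_le_mul_of_nonneg_left ?_ he.le
    rw [← Finset.mul_prod_erase _ _ (Finset.mem_univ k),
      ← Finset.mul_prod_erase _ (fun m => 1 - Real.exp (-(N * γ m))) (Finset.mem_univ k)]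
    nlinarith
  · rw [mul_left_comm]
    refine mul_le_mul_of_nonneg_left ?_ he.le
    nlinarith

lemma tendsto_root {r : ℕ → ℝ} {c d R : ℝ} (hc : 0 < c) (hd : 0 < d)
    (h : ∀ N : ℕ, 0 < N → c * Real.exp (N * R) ≤ r N ∧ r N ≤ d * Real.exp (N * R)) :
    Tendsto (fun N : ℕ => r N ^ ((N : ℝ))⁻¹) atTop (nhds (Real.exp R)) := by
  have key : ∀ c : ℝ, 0 < c →
      Tendsto (fun N : ℕ => (c * Real.exp (N * R)) ^ ((N : ℝ))⁻¹) atTop (nhds (Real.exp R)) := by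
    intro c hc
    have h1 : Tendsto (fun N : ℕ => c ^ ((N : ℝ))⁻¹ * Real.exp R) atTop
        (nhds (c ^ (0 : ℝ) * Real.exp R)) :=
      (((Real.continuous_const_rpow hc.ne').tendsto 0).comp
        (tendsto_inv_atTop_nhds_zero_nat (𝕜 := ℝ))).mul_const _
    rw [Real.rpow_zero, one_mul] at h1
    refine h1.congr' ?_
    filter_upwards [eventually_gt_atTop 0] with N hN
    have hN' : (N : ℝ) ≠ 0 := by positivity
    rw [Real.mul_rpow hc.le (Real.exp_pos _).le, ← Real.exp_mul, mul_right_comm,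
      mul_inv_cancel₀ hN', one_mul]
  refine tendsto_of_tendsto_of_tendsto_of_le_of_le' (key c hc) (key d hd) ?_ ?_
  · filter_upwards [eventually_gt_atTop 0] with N hN
    exact Real.rpow_le_rpow (by positivity) (h N hN).1 (by positivity)
  · filter_upwards [eventually_gt_atTop 0] with N hN
    exact Real.rpow_le_rpow (le_trans (by positivity) (h N hN).1) (h N hN).2 (by positivity)

lemma sum_range_two_mul_alternating (γ : ℕ → ℝ) (L : ℕ) :
    ∑ j ∈ Finset.range (2 * L), (-1 : ℝ) ^ (j + 1) * γ j =
      ∑ m : Fin L, γ (2 * m.val + 1) - ∑ m : Fin L, γ (2 * m.val) := by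
  induction L with
  | zero => simp
  | succ L ih =>
    rw [mul_add, mul_one, Finset.sum_range_succ, Finset.sum_range_succ, ih, Fin.sum_univ_castSucc,
      Fin.sum_univ_castSucc]
    simp only [Fin.val_castSucc, Fin.val_last, pow_succ, pow_mul]
    norm_num
    ring

/-- In the high-temperature (disordered) regime `ā > b` of the square-lattice Ising
model, where the dual coupling `ā` is defined by `sinh(2a) sinh(2ā) = 1` and
`γ_j ≥ 0` by `cosh γ_j = cosh(2ā)cosh(2b) − cos(πj/L2) sinh(2ā)sinh(2b)`
(so `γ_0 = 2(ā − b)`), one has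
`lim_{L1→∞} (1 − Z_Λ^{(−)}/Z_Λ)^{1/L1}
  = exp(−(γ_0 + (1/2) Σ_{j=0}^{2L2−1} (−1)^{j+1} γ_j))`. -/
theorem ising_twisted_ratio_L1_limit
    (L2 : ℕ) (hL2 : 0 < L2) (a b : ℝ) (ha : 0 < a) (hb : 0 < b)
    (abar : ℝ) (habar : 0 < abar)
    (hdual : Real.sinh (2 * a) * Real.sinh (2 * abar) = 1)
    (hht : b < abar)
    (gam : ℕ → ℝ)
    (hgam : ∀ j < 2 * L2, 0 ≤ gam j ∧
      Real.cosh (gam j) = Real.cosh (2 * abar) * Real.cosh (2 * b) -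
        Real.cos (Real.pi * j / L2) * (Real.sinh (2 * abar) * Real.sinh (2 * b))) :
    gam 0 = 2 * (abar - b) ∧
      Tendsto (fun L1 : ℕ => (1 - ZIm L1 L2 a b / ZI L1 L2 a b) ^ ((L1 : ℝ))⁻¹) atTop
        (nhds (Real.exp (-(gam 0 +
          (2 : ℝ)⁻¹ * ∑ j ∈ Finset.range (2 * L2), (-1 : ℝ) ^ (j + 1) * gam j)))) := by
  obtain ⟨hg0, hc0⟩ := hgam 0 (by omega)
  have hcosh0 : Real.cosh (gam 0) = Real.cosh (2 * abar - 2 * b) := by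
    rw [hc0, Real.cosh_sub]
    simp
  refine ⟨?_, ?_⟩
  · rw [← Real.arcosh_cosh hg0, hcosh0, Real.arcosh_cosh (by linarith)]
    ring
  · have hmin : ∀ j < 2 * L2, gam 0 ≤ gam j := by
      intro j hj
      obtain ⟨hgj, hcj⟩ := hgam j hj
      have h1 : Real.cosh (gam 0) ≤ Real.cosh (gam j) := by
        rw [hcosh0, Real.cosh_sub, hcj]
        have h2 : 0 ≤ Real.sinh (2 * abar) * Real.sinh (2 * b) :=
          mul_nonneg (Real.sinh_nonneg_iff.mpr (by linarith))
            (Real.sinh_nonneg_iff.mpr (by linarith))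
        nlinarith [Real.cos_le_one (Real.pi * j / L2)]
      rwa [Real.cosh_le_cosh, abs_of_nonneg hg0, abs_of_nonneg hgj] at h1
    set p : Fin L2 → ℝ := fun m => gam (2 * m.val + 1) with hp
    set q : Fin L2 → ℝ := fun m => gam (2 * m.val) with hq
    have hR : -(gam 0 + (2 : ℝ)⁻¹ * ∑ j ∈ Finset.range (2 * L2), (-1 : ℝ) ^ (j + 1) * gam j) =
        ((∑ m, q m) / 2 - gam 0) - (∑ m, p m) / 2 := by
      rw [sum_range_two_mul_alternating]
      ring
    rw [hR]
    refine tendsto_root (c := (2 * 2 ^ L2)⁻¹) (d := 2 * (2 * 2 ^ L2)) (by positivity)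
      (by positivity) fun N hN => ?_
    obtain ⟨c, hc, hsum, hdiff⟩ := partition_functions ha hb hdual hht gam hgam hN
    obtain ⟨hE1, hE2⟩ := sum_bounds p (fun m => (hgam _ (by omega)).1) N
    obtain ⟨hO1, hO2⟩ := diff_bounds q ⟨0, hL2⟩ hg0 (fun m => hmin _ (by omega)) N
    have hZ := ZI_pos N L2 a b
    have hZm := ZIm_nonneg N L2 a b
    rw [mul_sub (N : ℝ), Real.exp_sub]
    change Real.exp (N * ((∑ m, q m) / 2 - gam 0)) ≤ _ at hO1
    change _ ≤ 2 * 2 ^ L2 * Real.exp (N * ((∑ m, q m) / 2 - gam 0)) at hO2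
    have hX := Real.exp_pos (N * ((∑ m, p m) / 2))
    have hY := Real.exp_pos (N * ((∑ m, q m) / 2 - gam 0))
    have hK : (0 : ℝ) < 2 * 2 ^ L2 := by positivity
    have hratio : 1 - ZIm N L2 a b / ZI N L2 a b =
        (ZI N L2 a b - ZIm N L2 a b) / ZI N L2 a b := by
      field_simp
    rw [hratio]
    generalize Real.exp (N * ((∑ m, p m) / 2)) = X at *
    generalize Real.exp (N * ((∑ m, q m) / 2 - gam 0)) = Y at *
    generalize (2 : ℝ) * 2 ^ L2 = K at *
    generalize prodCosh p N + prodSinh p N = E at *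
    generalize prodCosh q N - prodSinh q N = O at *
    have hE : 0 < E := hX.trans_le hE1
    have hO : 0 < O := hY.trans_le hO1
    have hZle : ZI N L2 a b ≤ c * E := by linarith
    have hZge : c * E ≤ 2 * ZI N L2 a b := by nlinarith [mul_pos hc hO]
    rw [hdiff]
    constructor
    · rw [le_div_iff₀ hZ]
      calc K⁻¹ * (Y / X) * ZI N L2 a b ≤ K⁻¹ * (Y / X) * (c * (K * X)) := by
            refine mul_le_mul_of_nonneg_left (hZle.trans ?_) (by positivity)
            exact mul_le_mul_of_nonneg_left hE2 hc.le
        _ = c * Y := by field_simp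
        _ ≤ c * O := mul_le_mul_of_nonneg_left hO1 hc.le
    · rw [div_le_iff₀ hZ]
      calc c * O ≤ c * (K * Y) := mul_le_mul_of_nonneg_left hO2 hc.le
        _ = K * (Y / X) * (c * X) := by field_simp
        _ ≤ K * (Y / X) * (2 * ZI N L2 a b) := by
            refine mul_le_mul_of_nonneg_left (le_trans ?_ hZge) (by positivity)
            exact mul_le_mul_of_nonneg_left hE1 hc.le
        _ = 2 * K * (Y / X) * ZI N L2 a b := by ring

end TYIsing
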